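/- There exist absolute constants c > 0 and A > 0 with the following property. Let d ≥ 1, let K ≥ 1, and let H be a bounded open K-approximate group in ℝ^d (with Lebesgue measure). Then for every natural number M ≥ 1, the set S := {v ∈ ℝ^d : m·v ∈ 8H for all integers m with −M ≤ m ≤ M} has Lebesgue measure |S| ≥ c · exp(−A · (log(2K))^A · log(2M)) · |H|, where 8H denotes the eightfold sumset H + H + ... + H. -/

import Mathlib

open MeasureTheory Set
open scoped ENNReal Pointwise

/-- `H` is a `K`-approximate group: `0 ∈ H`, `H = -H`, and `H + H` is covered by at
most `K` translates of `H`. -/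
def IsApproxGroup {V : Type*} [AddCommGroup V] (K : ℝ) (H : Set V) : Prop :=
  (0 : V) ∈ H ∧ H = -H ∧
    ∃ T : Finset V, (T.card : ℝ) ≤ K ∧ H + H ⊆ (T : Set V) + H

/-- The `n`-fold iterated sumset `s + s + ⋯ + s` (`n` times). -/
def nfoldSum {V : Type*} [AddCommGroup V] : ℕ → Set V → Set V
  | 0, _ => {0}
  | n + 1, s => s + nfoldSum n s

section Hoeffding

lemma exp_mul_le_cosh_add_mul_sinh {x : ℝ} (hx : |x| ≤ 1) (s : ℝ) :
    Real.exp (s * x) ≤ Real.cosh s + x * Real.sinh s := by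
  obtain ⟨h1, h2⟩ := abs_le.1 hx
  have h := convexOn_exp.2 (Set.mem_univ s) (Set.mem_univ (-s))
    (show (0 : ℝ) ≤ (1 + x) / 2 by linarith) (show (0 : ℝ) ≤ (1 - x) / 2 by linarith) (by ring)
  simp only [smul_eq_mul] at h
  rw [Real.cosh_eq, Real.sinh_eq]
  calc Real.exp (s * x) = Real.exp ((1 + x) / 2 * s + (1 - x) / 2 * -s) := by ring_nf
    _ ≤ _ := h
    _ = _ := by ring

/-- **Hoeffding's inequality** for samples drawn uniformly from a finite set. -/
lemma card_filter_le_sum_le_exp {α : Type*} [DecidableEq α] (E : Finset α) (X : α → ℝ)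
    (hX : ∀ e ∈ E, |X e| ≤ 1) (hsum : ∑ e ∈ E, X e = 0) (n : ℕ) (ε : ℝ) (hε : 0 ≤ ε) :
    (((Fintype.piFinset fun _ : Fin n ↦ E).filter fun a ↦ n * ε ≤ ∑ i, X (a i)).card : ℝ) ≤
      (E.card : ℝ) ^ n * Real.exp (-(n * ε ^ 2 / 2)) := by
  have hmgf : ∑ e ∈ E, Real.exp (ε * X e) ≤ E.card * Real.exp (ε ^ 2 / 2) := by
    calc ∑ e ∈ E, Real.exp (ε * X e) ≤ ∑ e ∈ E, (Real.cosh ε + X e * Real.sinh ε) :=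
          Finset.sum_le_sum fun e he ↦ exp_mul_le_cosh_add_mul_sinh (hX e he) ε
      _ = E.card * Real.cosh ε := by
          rw [Finset.sum_add_distrib, ← Finset.sum_mul, hsum]; simp
      _ ≤ _ := by gcongr; exact Real.cosh_le_exp_half_sq ε
  have hprod : ∑ a ∈ Fintype.piFinset fun _ : Fin n ↦ E, Real.exp (ε * ∑ i, X (a i)) =
      (∑ e ∈ E, Real.exp (ε * X e)) ^ n := by
    have := Finset.prod_univ_sum (fun _ : Fin n ↦ E) fun _ e ↦ Real.exp (ε * X e)
    simp only [Finset.prod_const, Finset.card_univ, Fintype.card_fin] at this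
    rw [this]
    simp [Finset.mul_sum, Real.exp_sum]
  set B := (Fintype.piFinset fun _ : Fin n ↦ E).filter fun a ↦ n * ε ≤ ∑ i, X (a i)
  have hmarkov : B.card * Real.exp (n * ε ^ 2) ≤ (E.card * Real.exp (ε ^ 2 / 2)) ^ n := by
    calc B.card * Real.exp (n * ε ^ 2) = ∑ a ∈ B, Real.exp (n * ε ^ 2) := by simp
      _ ≤ ∑ a ∈ B, Real.exp (ε * ∑ i, X (a i)) := by
          refine Finset.sum_le_sum fun a ha ↦ Real.exp_le_exp.2 ?_
          have := (Finset.mem_filter.1 ha).2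
          nlinarith
      _ ≤ ∑ a ∈ Fintype.piFinset fun _ : Fin n ↦ E, Real.exp (ε * ∑ i, X (a i)) :=
          Finset.sum_le_sum_of_subset_of_nonneg (Finset.filter_subset _ _)
            fun _ _ _ ↦ (Real.exp_pos _).le
      _ ≤ _ := by
          rw [hprod]
          exact pow_le_pow_left₀ (Finset.sum_nonneg fun _ _ ↦ (Real.exp_pos _).le) hmgf n
  rw [mul_pow, ← Real.exp_nat_mul] at hmarkov
  calc (B.card : ℝ) = B.card * Real.exp (n * ε ^ 2) * Real.exp (-(n * ε ^ 2)) := by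
        rw [mul_assoc, ← Real.exp_add]; simp
    _ ≤ (E.card : ℝ) ^ n * Real.exp (n * (ε ^ 2 / 2)) * Real.exp (-(n * ε ^ 2)) := by gcongr
    _ = _ := by rw [mul_assoc, ← Real.exp_add]; ring_nf

end Hoeffding

section AlmostPeriodicity

variable {G : Type*} [AddCommGroup G] [DecidableEq G]

/-- The proportion of `e ∈ E` with `x + e ∈ S`. -/
noncomputable def hitRate (E S : Finset G) (x : G) : ℝ :=
  ((E.filter fun e ↦ x + e ∈ S).card : ℝ) / E.card

/-- The number of indices `i` with `x + a i ∈ S`. -/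
noncomputable def hitCount (S : Finset G) {n : ℕ} (a : Fin n → G) (x : G) : ℝ :=
  ∑ i, if x + a i ∈ S then (1 : ℝ) else 0

lemma card_filter_abs_hitCount_sub_le (E S : Finset G) (hE : E.Nonempty) (n : ℕ) (ε : ℝ)
    (hε : 0 ≤ ε) (x : G) :
    (((Fintype.piFinset fun _ : Fin n ↦ E).filter fun a ↦
        n * ε ≤ |hitCount S a x - n * hitRate E S x|).card : ℝ) ≤
      2 * ((E.card : ℝ) ^ n * Real.exp (-(n * ε ^ 2 / 2))) := by
  have hE' : (0 : ℝ) < E.card := by exact_mod_cast hE.card_pos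
  set X : G → ℝ := fun e ↦ (if x + e ∈ S then (1 : ℝ) else 0) - hitRate E S x with hXdef
  have hr0 : 0 ≤ hitRate E S x := by unfold hitRate; positivity
  have hr1 : hitRate E S x ≤ 1 := by
    unfold hitRate
    rw [div_le_one hE']
    exact_mod_cast Finset.card_filter_le _ _
  have hX : ∀ e ∈ E, |X e| ≤ 1 := by
    intro e _
    simp only [hXdef]
    split_ifs <;> rw [abs_le] <;> constructor <;> linarith
  have hsum : ∑ e ∈ E, X e = 0 := by
    simp only [hXdef, Finset.sum_sub_distrib, Finset.sum_boole, Finset.sum_const, nsmul_eq_mul]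
    unfold hitRate
    field_simp
    ring
  have hdiff : ∀ a : Fin n → G, ∑ i, X (a i) = hitCount S a x - n * hitRate E S x := by
    intro a
    simp [hXdef, hitCount, Finset.sum_sub_distrib]
  have h1 := card_filter_le_sum_le_exp E X hX hsum n ε hε
  have h2 := card_filter_le_sum_le_exp E (fun e ↦ -X e) (by simpa using hX) (by simp [hsum]) n ε hε
  have hsub : ((Fintype.piFinset fun _ : Fin n ↦ E).filter fun a ↦
        n * ε ≤ |hitCount S a x - n * hitRate E S x|) ⊆
      ((Fintype.piFinset fun _ : Fin n ↦ E).filter fun a ↦ n * ε ≤ ∑ i, X (a i)) ∪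
      ((Fintype.piFinset fun _ : Fin n ↦ E).filter fun a ↦ n * ε ≤ ∑ i, -X (a i)) := by
    intro a ha
    simp only [Finset.mem_union, Finset.mem_filter, Finset.sum_neg_distrib, hdiff] at ha ⊢
    rcases le_abs.1 ha.2 with h | h
    · exact .inl ⟨ha.1, h⟩
    · exact .inr ⟨ha.1, h⟩
  have := (Finset.card_le_card hsub).trans (Finset.card_union_le _ _)
  have h3 : (((Fintype.piFinset fun _ : Fin n ↦ E).filter fun a ↦
        n * ε ≤ |hitCount S a x - n * hitRate E S x|).card : ℝ) ≤
      ((Fintype.piFinset fun _ : Fin n ↦ E).filter fun a ↦ n * ε ≤ ∑ i, X (a i)).card +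
      ((Fintype.piFinset fun _ : Fin n ↦ E).filter fun a ↦ n * ε ≤ ∑ i, -X (a i)).card := by
    exact_mod_cast this
  linarith

end AlmostPeriodicity

section CrootSisask

open scoped _root_.Pointwise

variable {G : Type*} [AddCommGroup G] [Fintype G] [DecidableEq G]

/-- The points at which the sample `a` estimates the hit rate with error at least `ε`. -/
noncomputable def badPoints (E S : Finset G) (n : ℕ) (ε : ℝ) (a : Fin n → G) : Finset G :=
  Finset.univ.filter fun x ↦ n * ε ≤ |hitCount S a x - n * hitRate E S x|

/-- At least half of the samples have few bad points. -/
lemma card_le_two_mul_card_filter_badPoints (E S : Finset G) (hE : E.Nonempty) (n : ℕ) (ε : ℝ)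
    (hε : 0 ≤ ε) :
    (E.card : ℝ) ^ n ≤ 2 * ((Fintype.piFinset fun _ : Fin n ↦ E).filter fun a ↦
      ((badPoints E S n ε a).card : ℝ) ≤
        4 * Real.exp (-(n * ε ^ 2 / 2)) * Fintype.card G).card := by
  set q := Real.exp (-(n * ε ^ 2 / 2))
  have hq : 0 < q := Real.exp_pos _
  have hG : (0 : ℝ) < Fintype.card G := by exact_mod_cast Fintype.card_pos
  set P := Fintype.piFinset fun _ : Fin n ↦ E
  have hP : (P.card : ℝ) = (E.card : ℝ) ^ n := by simp [P]
  have hcount : ∑ a ∈ P, ((badPoints E S n ε a).card : ℝ) ≤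
      Fintype.card G * (2 * ((E.card : ℝ) ^ n * q)) := by
    have h : ∑ a ∈ P, (badPoints E S n ε a).card =
        ∑ x : G, (P.filter fun a ↦ n * ε ≤ |hitCount S a x - n * hitRate E S x|).card := by
      simp only [badPoints, Finset.card_filter]
      exact Finset.sum_comm
    have h' : ∑ a ∈ P, ((badPoints E S n ε a).card : ℝ) = ∑ x : G,
        ((P.filter fun a ↦ n * ε ≤ |hitCount S a x - n * hitRate E S x|).card : ℝ) := by
      exact_mod_cast h
    rw [h']
    calc _ ≤ ∑ _x : G, 2 * ((E.card : ℝ) ^ n * q) :=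
          Finset.sum_le_sum fun x _ ↦ card_filter_abs_hitCount_sub_le E S hE n ε hε x
      _ = _ := by simp
  set B := P.filter fun a ↦ ¬ ((badPoints E S n ε a).card : ℝ) ≤ 4 * q * Fintype.card G
  have hB : B.card * (4 * q * Fintype.card G) ≤ Fintype.card G * (2 * ((E.card : ℝ) ^ n * q)) := by
    calc B.card * (4 * q * Fintype.card G) = ∑ _a ∈ B, (4 * q * Fintype.card G) := by simp
      _ ≤ ∑ a ∈ B, ((badPoints E S n ε a).card : ℝ) :=
          Finset.sum_le_sum fun a ha ↦ (not_le.1 (Finset.mem_filter.1 ha).2).le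
      _ ≤ ∑ a ∈ P, ((badPoints E S n ε a).card : ℝ) :=
          Finset.sum_le_sum_of_subset_of_nonneg (Finset.filter_subset _ _)
            fun _ _ _ ↦ Nat.cast_nonneg _
      _ ≤ _ := hcount
  have hB' : 2 * (B.card : ℝ) ≤ (E.card : ℝ) ^ n := by
    have : (0 : ℝ) < 2 * q * Fintype.card G := by positivity
    refine le_of_mul_le_mul_right ?_ this
    linarith
  have hsplit := Finset.card_filter_add_card_filter_not (s := P)
    fun a ↦ ((badPoints E S n ε a).card : ℝ) ≤ 4 * q * Fintype.card G
  have hsplit' : ((P.filter fun a ↦ ((badPoints E S n ε a).card : ℝ) ≤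
      4 * q * Fintype.card G).card : ℝ) + B.card = P.card := by exact_mod_cast hsplit
  linarith

/-- Some tuple has many diagonal translates in a given set of tuples. -/
lemma exists_card_filter_translate_mem {n : ℕ} (L : Finset (Fin n → G)) :
    ∃ b : Fin n → G, Fintype.card G * L.card ≤
      (Finset.univ.filter fun t : G ↦ (fun i ↦ b i + t) ∈ L).card * Fintype.card G ^ n := by
  by_contra! h
  have hsum : ∑ b : Fin n → G, (Finset.univ.filter fun t : G ↦ (fun i ↦ b i + t) ∈ L).card =
      Fintype.card G * L.card := by
    simp only [Finset.card_filter]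
    rw [Finset.sum_comm]
    have : ∀ t : G, ∑ b : Fin n → G, (if (fun i ↦ b i + t) ∈ L then 1 else 0) = L.card := by
      intro t
      have := Fintype.sum_equiv (Equiv.addRight fun _ : Fin n ↦ t)
        (fun b ↦ if (fun i ↦ b i + t) ∈ L then 1 else 0) (fun b ↦ if b ∈ L then 1 else 0)
        fun b ↦ rfl
      rw [this]
      simp
    simp [this]
  have := Finset.sum_lt_sum_of_nonempty (s := (Finset.univ : Finset (Fin n → G)))
    Finset.univ_nonempty fun b _ ↦ h b
  rw [← Finset.sum_mul, hsum] at this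
  simp only [Finset.sum_const, Finset.card_univ, Fintype.card_fun, Fintype.card_fin,
    smul_eq_mul] at this
  rw [mul_comm] at this
  exact lt_irrefl _ this

/-- **Almost periodicity** of the hit rate, outside a small exceptional set. -/
lemma exists_almost_periods (E S : Finset G) (hE : E.Nonempty) (n : ℕ) (hn : 0 < n) (ε : ℝ)
    (hε : 0 ≤ ε) :
    ∃ T : Finset G, (Fintype.card G : ℝ) * (E.card : ℝ) ^ n ≤
        2 * T.card * (Fintype.card G : ℝ) ^ n ∧
      ∀ t ∈ T, ∀ t' ∈ T,
        ((Finset.univ.filter fun x ↦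
          2 * ε < |hitRate E S (x + (t - t')) - hitRate E S x|).card : ℝ) ≤
        8 * Real.exp (-(n * ε ^ 2 / 2)) * Fintype.card G := by
  set q := Real.exp (-(n * ε ^ 2 / 2))
  set L := (Fintype.piFinset fun _ : Fin n ↦ E).filter fun a ↦
      ((badPoints E S n ε a).card : ℝ) ≤ 4 * q * Fintype.card G with hL
  have hn' : (0 : ℝ) < n := by exact_mod_cast hn
  obtain ⟨b, hb⟩ := exists_card_filter_translate_mem L
  refine ⟨Finset.univ.filter fun t : G ↦ (fun i ↦ b i + t) ∈ L, ?_, ?_⟩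
  · have h1 := card_le_two_mul_card_filter_badPoints E S hE n ε hε
    have h2 : (Fintype.card G : ℝ) * L.card ≤
      (Finset.univ.filter fun t : G ↦ (fun i ↦ b i + t) ∈ L).card *
        (Fintype.card G : ℝ) ^ n := by exact_mod_cast hb
    calc _ ≤ (Fintype.card G : ℝ) * (2 * L.card) := by gcongr
      _ ≤ _ := by linarith
  · intro t ht t' ht'
    simp only [Finset.mem_filter, Finset.mem_univ, true_and, hL] at ht ht'
    set B := badPoints E S n ε fun i ↦ b i + t
    set B' := badPoints E S n ε fun i ↦ b i + t'
    have hshift : ∀ s x : G, hitCount S (fun i ↦ b i + s) x = hitCount S b (x + s) := by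
      intro s x
      unfold hitCount
      refine Finset.sum_congr rfl fun i _ ↦ ?_
      rw [show x + (b i + s) = x + s + b i by abel]
    have hsub : (Finset.univ.filter fun x ↦
          2 * ε < |hitRate E S (x + (t - t')) - hitRate E S x|) ⊆
        B'.image (fun x ↦ x - (t - t')) ∪ B := by
      intro x hx
      simp only [Finset.mem_filter, Finset.mem_univ, true_and, Finset.mem_union,
        Finset.mem_image] at hx ⊢
      by_contra! hcon
      have h1 : x ∉ B := hcon.2
      have h2 : x + (t - t') ∉ B' := fun h ↦ hcon.1 _ h (by abel)
      simp only [B, B', badPoints, Finset.mem_filter, Finset.mem_univ, true_and, not_le,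
        hshift] at h1 h2
      rw [show x + (t - t') + t' = x + t by abel] at h2
      have h3 : n * |hitRate E S (x + (t - t')) - hitRate E S x| < n * (2 * ε) := by
        rw [← abs_of_pos hn', ← abs_mul, abs_of_pos hn']
        rw [abs_lt] at h1 h2 ⊢
        constructor <;> linarith [h1.1, h1.2, h2.1, h2.2]
      exact absurd hx (not_lt.2 (lt_of_mul_lt_mul_left h3 hn'.le).le)
    have hc : ((Finset.univ.filter fun x ↦
          2 * ε < |hitRate E S (x + (t - t')) - hitRate E S x|).card : ℝ) ≤
        B'.card + B.card := by
      exact_mod_cast (Finset.card_le_card hsub).trans <| (Finset.card_union_le _ _).trans <|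
        Nat.add_le_add_right Finset.card_image_le _
    linarith [ht.2, ht'.2]

lemma card_filter_hitRate_sum_le (E S T : Finset G) (ε β : ℝ)
    (hT : ∀ t ∈ T, ((Finset.univ.filter fun x ↦
      2 * ε < |hitRate E S (x + t) - hitRate E S x|).card : ℝ) ≤ β) (k : ℕ) (t : Fin k → G)
    (ht : ∀ i, t i ∈ T) :
    ((Finset.univ.filter fun x ↦
      2 * ε * k < |hitRate E S (x + ∑ i, t i) - hitRate E S x|).card : ℝ) ≤ k * β := by
  induction k with
  | zero => simp
  | succ k ih =>
    have ih' := ih (fun i ↦ t i.castSucc) fun i ↦ ht _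
    have hlast := hT _ (ht (Fin.last k))
    rw [Fin.sum_univ_castSucc]
    set s := ∑ i : Fin k, t i.castSucc
    set u := t (Fin.last k)
    have hsub : (Finset.univ.filter fun x ↦
          2 * ε * (k + 1 : ℕ) < |hitRate E S (x + (s + u)) - hitRate E S x|) ⊆
        (Finset.univ.filter fun x ↦ 2 * ε * k < |hitRate E S (x + s) - hitRate E S x|) ∪
        (Finset.univ.filter fun x ↦ 2 * ε < |hitRate E S (x + u) - hitRate E S x|).image
          (fun x ↦ x - s) := by
      intro x hx
      simp only [Finset.mem_filter, Finset.mem_univ, true_and, Finset.mem_union,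
        Finset.mem_image] at hx ⊢
      by_contra! hcon
      have h2 : |hitRate E S (x + s + u) - hitRate E S (x + s)| ≤ 2 * ε := by
        by_contra! h
        exact hcon.2 _ h (by abel)
      rw [show x + s + u = x + (s + u) by abel] at h2
      have := abs_sub_le (hitRate E S (x + (s + u))) (hitRate E S (x + s)) (hitRate E S x)
      push_cast at hx
      linarith [hcon.1]
    have hc := (Finset.card_le_card hsub).trans <| (Finset.card_union_le _ _).trans <|
        Nat.add_le_add_left Finset.card_image_le _
    have hc' := (Nat.cast_le (α := ℝ)).2 hc
    push_cast at hc' ⊢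
    linarith

/-- A dense set `E` admits a dense set `T` such that all `k`-fold sums of elements of `T - T`
belong to `(E + E) - (E + E)`. -/
lemma exists_sum_mem_sub (E : Finset G) (hE : E.Nonempty) (n : ℕ) (hn : 0 < n) (k : ℕ)
    (hk : 0 < k)
    (hq : 8 * Real.exp (-(n / (32 * k ^ 2))) * k * Fintype.card G < E.card) :
    ∃ T : Finset G, (Fintype.card G : ℝ) * (E.card : ℝ) ^ n ≤
        2 * T.card * (Fintype.card G : ℝ) ^ n ∧
      ∀ t : Fin k → G, (∀ i, t i ∈ T - T) → ∑ i, t i ∈ (E + E) - (E + E) := by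
  have hk' : (0 : ℝ) < k := by exact_mod_cast hk
  have hE' : (0 : ℝ) < E.card := by exact_mod_cast hE.card_pos
  obtain ⟨T, hTcard, hT⟩ := exists_almost_periods E (E + E) hE n hn (1 / (4 * k)) (by positivity)
  refine ⟨T, hTcard, fun t ht ↦ ?_⟩
  have h := card_filter_hitRate_sum_le E (E + E) (T - T) _ _ (fun t ht ↦ by
    obtain ⟨a, ha, b, hb, rfl⟩ := Finset.mem_sub.1 ht
    exact hT a ha b hb) k t ht
  have hlt := h.trans_lt (b := (k : ℝ) * _) (c := (E.card : ℝ)) (by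
    refine lt_of_eq_of_lt ?_ hq
    rw [show (n : ℝ) * (1 / (4 * k)) ^ 2 / 2 = n / (32 * k ^ 2) by field_simp; norm_num]
    ring)
  obtain ⟨x, hxE, hx⟩ := Finset.exists_mem_notMem_of_card_lt_card (Nat.cast_lt.1 hlt)
  have hone : hitRate E (E + E) x = 1 := by
    unfold hitRate
    rw [Finset.filter_true_of_mem fun e he ↦ Finset.add_mem_add hxE he, div_self hE'.ne']
  simp only [Finset.mem_filter, Finset.mem_univ, true_and, not_lt, hone] at hx
  have hpos : 0 < hitRate E (E + E) (x + ∑ i, t i) := by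
    rw [show 2 * (1 / (4 * (k : ℝ))) * k = 1 / 2 by field_simp; norm_num] at hx
    linarith [(abs_le.1 hx).1]
  have hne : (E.filter fun e ↦ x + ∑ i, t i + e ∈ E + E).Nonempty := by
    rw [Finset.nonempty_iff_ne_empty]
    intro h0
    simp [hitRate, h0] at hpos
  obtain ⟨e, he⟩ := hne
  obtain ⟨heE, he⟩ := Finset.mem_filter.1 he
  exact Finset.mem_sub.2 ⟨_, he, _, Finset.add_mem_add hxE heE, by abel⟩

end CrootSisask

section Spectrum

variable {G : Type*} [AddCommGroup G] [Fintype G]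

/-- The characters at which the Fourier transform of `T` is at least half of its maximum. -/
noncomputable def largeSpectrum (T : Finset G) : Finset (AddChar G ℂ) :=
  Finset.univ.filter fun ψ ↦ (T.card : ℝ) / 2 ≤ ‖∑ t ∈ T, ψ t‖

/-- **Chang's theorem**: dissociated subsets of the large spectrum are small. -/
lemma card_le_of_addDissociated_subset_largeSpectrum (T : Finset G) (hT : T.Nonempty)
    (Λ : Finset (AddChar G ℂ)) (hΛ : Λ ⊆ largeSpectrum T)
    (hdis : AddDissociated (Λ : Set (AddChar G ℂ))) :
    (Λ.card : ℝ) ≤ 8 * Real.log (Fintype.card G / T.card) := by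
  have hT' : (0 : ℝ) < T.card := by exact_mod_cast hT.card_pos
  have hG : (0 : ℝ) < Fintype.card G := by exact_mod_cast Fintype.card_pos
  set S : AddChar G ℂ → ℂ := fun ψ ↦ ∑ t ∈ T, ψ t
  set u : AddChar G ℂ → ℂ := fun ψ ↦ (starRingEnd ℂ) (S ψ) / ‖S ψ‖ with hu
  have hunorm : ∀ ψ, ‖u ψ‖ ≤ 1 := by
    intro ψ
    simp only [hu, norm_div, RCLike.norm_conj, Complex.norm_real, norm_norm]
    exact div_self_le_one _
  have huS : ∀ ψ, (u ψ * S ψ).re = ‖S ψ‖ := by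
    intro ψ
    simp only [hu]
    rw [div_mul_eq_mul_div, mul_comm, Complex.mul_conj']
    by_cases h : ‖S ψ‖ = 0
    · simp [h]
    · rw [sq, mul_div_assoc, div_self (by exact_mod_cast h), mul_one, Complex.ofReal_re]
  set c : AddChar G ℂ → ℝ := fun ψ ↦ if ψ ∈ Λ then Real.cosh (1 / 2) else 1
  set d : AddChar G ℂ → ℂ := fun ψ ↦ if ψ ∈ Λ then Real.sinh (1 / 2) * u ψ else 0
  have hrand := AddDissociated.randomisation c d (hdis.subset fun ψ hψ ↦ by
    by_contra h
    exact hψ (if_neg h))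
  have hprod : ∀ a : G, ∏ ψ, (c ψ + (d ψ * ψ a).re) =
      ∏ ψ ∈ Λ, (Real.cosh (1 / 2) + (u ψ * ψ a).re * Real.sinh (1 / 2)) := by
    intro a
    rw [← Finset.prod_subset (Finset.subset_univ Λ)]
    · refine Finset.prod_congr rfl fun ψ hψ ↦ ?_
      simp only [c, d, if_pos hψ]
      rw [mul_assoc, Complex.re_ofReal_mul, mul_comm]
    · intro ψ _ hψ
      simp [c, d, hψ]
  have hprodc : ∏ ψ, c ψ = Real.cosh (1 / 2) ^ Λ.card := by
    rw [← Finset.prod_subset (Finset.subset_univ Λ)]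
    · rw [← Finset.prod_const]
      exact Finset.prod_congr rfl fun ψ hψ ↦ if_pos hψ
    · intro ψ _ hψ
      simp [c, hψ]
  rw [Fintype.expect_eq_sum_div_card, div_eq_iff hG.ne', hprodc] at hrand
  set g : G → ℝ := fun a ↦ ∑ ψ ∈ Λ, 1 / 2 * (u ψ * ψ a).re
  have hle : ∀ a, Real.exp (g a) ≤ ∏ ψ, (c ψ + (d ψ * ψ a).re) := by
    intro a
    rw [hprod, Real.exp_sum]
    refine Finset.prod_le_prod (fun _ _ ↦ (Real.exp_pos _).le) fun ψ _ ↦ ?_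
    refine exp_mul_le_cosh_add_mul_sinh ?_ _
    refine (Complex.abs_re_le_norm _).trans ?_
    rw [norm_mul, AddChar.norm_apply, mul_one]
    exact hunorm ψ
  have hupper : ∑ a ∈ T, Real.exp (g a) ≤ Real.exp (Λ.card / 8) * Fintype.card G := by
    calc ∑ a ∈ T, Real.exp (g a) ≤ ∑ a, Real.exp (g a) :=
          Finset.sum_le_sum_of_subset_of_nonneg (Finset.subset_univ _)
            fun _ _ _ ↦ (Real.exp_pos _).le
      _ ≤ ∑ a, ∏ ψ, (c ψ + (d ψ * ψ a).re) := Finset.sum_le_sum fun a _ ↦ hle a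
      _ = Real.cosh (1 / 2) ^ Λ.card * Fintype.card G := hrand
      _ ≤ Real.exp ((1 / 2) ^ 2 / 2) ^ Λ.card * Fintype.card G := by
          gcongr
          exact Real.cosh_le_exp_half_sq _
      _ = _ := by rw [← Real.exp_nat_mul]; congr 2; ring
  have hgsum : T.card * ((Λ.card : ℝ) / 4) ≤ ∑ a ∈ T, g a := by
    have : ∑ a ∈ T, g a = ∑ ψ ∈ Λ, 1 / 2 * ‖S ψ‖ := by
      simp only [g]
      rw [Finset.sum_comm]
      refine Finset.sum_congr rfl fun ψ _ ↦ ?_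
      rw [← huS, ← Finset.mul_sum, ← Complex.re_sum, ← Finset.mul_sum]
    rw [this]
    calc T.card * ((Λ.card : ℝ) / 4) = ∑ _ψ ∈ Λ, (T.card : ℝ) / 4 := by simp; ring
      _ ≤ _ := Finset.sum_le_sum fun ψ hψ ↦ by
        have := (Finset.mem_filter.1 (hΛ hψ)).2
        simp only [S]
        linarith
  have hlower : T.card * Real.exp (Λ.card / 4) ≤ ∑ a ∈ T, Real.exp (g a) := by
    calc T.card * Real.exp (Λ.card / 4) ≤
        Real.exp (Λ.card / 4) * (T.card + (∑ a ∈ T, g a - T.card * ((Λ.card : ℝ) / 4))) := by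
          nlinarith [Real.exp_pos ((Λ.card : ℝ) / 4)]
      _ = ∑ a ∈ T, Real.exp (Λ.card / 4) * ((g a - Λ.card / 4) + 1) := by
          rw [← Finset.mul_sum, Finset.sum_add_distrib, Finset.sum_sub_distrib]
          simp
          ring
      _ ≤ ∑ a ∈ T, Real.exp (g a) := Finset.sum_le_sum fun a _ ↦ by
          calc _ ≤ Real.exp (Λ.card / 4) * Real.exp (g a - Λ.card / 4) := by
                gcongr; exact Real.add_one_le_exp _
            _ = _ := by rw [← Real.exp_add]; congr 1; ring
  have hfin : Real.exp (Λ.card / 8) ≤ Fintype.card G / T.card := by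
    rw [le_div_iff₀ hT']
    have h := hlower.trans hupper
    rw [show (Λ.card : ℝ) / 4 = Λ.card / 8 + Λ.card / 8 by ring, Real.exp_add] at h
    nlinarith [Real.exp_pos ((Λ.card : ℝ) / 8)]
  have := (Real.le_log_iff_exp_le (by positivity)).2 hfin
  linarith

lemma norm_prod_sub_one_le {ι : Type*} (s : Finset ι) (f : ι → ℂ) (hf : ∀ i ∈ s, ‖f i‖ ≤ 1) :
    ‖∏ i ∈ s, f i - 1‖ ≤ ∑ i ∈ s, ‖f i - 1‖ := by
  classical
  induction s using Finset.induction_on with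
  | empty => simp
  | insert a s ha ih =>
    rw [Finset.prod_insert ha, Finset.sum_insert ha]
    have h := ih fun i hi ↦ hf i (Finset.mem_insert_of_mem hi)
    have ha' := hf a (Finset.mem_insert_self a s)
    calc ‖f a * ∏ i ∈ s, f i - 1‖ = ‖(f a - 1) + f a * (∏ i ∈ s, f i - 1)‖ := by ring_nf
      _ ≤ ‖f a - 1‖ + ‖f a‖ * ‖∏ i ∈ s, f i - 1‖ := by
          rw [← norm_mul]; exact norm_add_le _ _
      _ ≤ _ := by nlinarith [norm_nonneg (∏ i ∈ s, f i - 1)]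

lemma norm_inv_sub_one {z : ℂ} (hz : ‖z‖ = 1) : ‖z⁻¹ - 1‖ = ‖z - 1‖ := by
  have h0 : z ≠ 0 := norm_pos_iff.1 (by rw [hz]; exact one_pos)
  have : z⁻¹ - 1 = -(z⁻¹ * (z - 1)) := by
    field_simp
    ring
  rw [this, norm_neg, norm_mul, norm_inv, hz, inv_one, one_mul]

lemma norm_sub_one_le_of_mem_addSpan [DecidableEq (AddChar G ℂ)] {Λ : Finset (AddChar G ℂ)}
    {ψ : AddChar G ℂ} (hψ : ψ ∈ Λ.addSpan) {x : G} {r : ℝ}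
    (hx : ∀ χ ∈ Λ, ‖χ x - 1‖ ≤ r) : ‖ψ x - 1‖ ≤ Λ.card * r := by
  obtain ⟨ε, hε, rfl⟩ := Finset.mem_addSpan.1 hψ
  rw [AddChar.sum_apply]
  refine (norm_prod_sub_one_le _ _ fun χ _ ↦ (AddChar.norm_apply _ _).le).trans ?_
  rw [← nsmul_eq_mul]
  refine Finset.sum_le_card_nsmul _ _ _ fun χ hχ ↦ ?_
  rw [AddChar.zsmul_apply]
  rcases hε χ with h | h | h
  · rw [h, zpow_neg_one, norm_inv_sub_one (AddChar.norm_apply χ x)]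
    exact hx χ hχ
  · rw [h, zpow_zero, sub_self, norm_zero]
    exact (norm_nonneg _).trans (hx χ hχ)
  · rw [h, zpow_one]
    exact hx χ hχ

lemma norm_zsmul_sub_one_le (ψ : AddChar G ℂ) (x : G) (m : ℤ) :
    ‖ψ (m • x) - 1‖ ≤ |(m : ℝ)| * ‖ψ x - 1‖ := by
  have hnat : ∀ n : ℕ, ‖ψ x ^ n - 1‖ ≤ n * ‖ψ x - 1‖ := by
    intro n
    have := norm_prod_sub_one_le (Finset.range n) (fun _ ↦ ψ x)
      fun _ _ ↦ (AddChar.norm_apply _ _).le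
    simpa using this
  rw [AddChar.map_zsmul_eq_zpow]
  obtain ⟨n, rfl | rfl⟩ := m.eq_nat_or_neg
  · simpa using hnat n
  · have h : ‖ψ x ^ n‖ = 1 := by rw [norm_pow, AddChar.norm_apply, one_pow]
    rw [zpow_neg, zpow_natCast, norm_inv_sub_one h]
    simpa using hnat n

/-- **Bohr sets are large.** -/
lemma exists_bohr_set (Λ : Finset (AddChar G ℂ)) (n : ℕ) (hn : 0 < n) :
    ∃ B : Finset G, Fintype.card G ≤ ((2 * n + 1) ^ 2) ^ Λ.card * B.card ∧
      ∀ x ∈ B, ∀ ψ ∈ Λ, ‖ψ x - 1‖ ≤ 2 / n := by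
  classical
  have hn' : (0 : ℝ) < n := by exact_mod_cast hn
  set I : Finset (ℤ × ℤ) := Finset.Icc (-n : ℤ) n ×ˢ Finset.Icc (-n : ℤ) n
  have hI : I.card = (2 * n + 1) ^ 2 := by
    simp only [I, Finset.card_product, Int.card_Icc]
    rw [show ((n : ℤ) + 1 - -n).toNat = 2 * n + 1 by omega]
    ring
  set P := Fintype.piFinset fun _ : Λ ↦ I
  have hP : P.card = ((2 * n + 1) ^ 2) ^ Λ.card := by simp [P, hI]
  set F : G → Λ → ℤ × ℤ := fun x ψ ↦ (⌊n * (ψ.1 x).re⌋, ⌊n * (ψ.1 x).im⌋)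
  have hfl : ∀ y : ℝ, |y| ≤ 1 → ⌊n * y⌋ ∈ Finset.Icc (-n : ℤ) n := by
    intro y hy
    obtain ⟨h1, h2⟩ := abs_le.1 hy
    rw [Finset.mem_Icc]
    constructor
    · rw [Int.le_floor]; push_cast; nlinarith
    · have : ((⌊n * y⌋ : ℤ) : ℝ) ≤ (n : ℤ) := (Int.floor_le _).trans (by push_cast; nlinarith)
      exact_mod_cast this
  have hF : ∀ x ∈ (Finset.univ : Finset G), F x ∈ P := by
    intro x _
    refine Fintype.mem_piFinset.2 fun ψ ↦ Finset.mem_product.2 ⟨hfl _ ?_, hfl _ ?_⟩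
    · exact (Complex.abs_re_le_norm _).trans (AddChar.norm_apply _ _).le
    · exact (Complex.abs_im_le_norm _).trans (AddChar.norm_apply _ _).le
  obtain ⟨y, -, hy⟩ : ∃ y ∈ P, Fintype.card G ≤
      P.card * (Finset.univ.filter fun x ↦ F x = y).card := by
    by_contra! h
    have hPne : P.Nonempty := ⟨_, hF 0 (Finset.mem_univ _)⟩
    have h1 := Finset.sum_lt_sum_of_nonempty hPne h
    rw [← Finset.mul_sum, ← Finset.card_eq_sum_card_fiberwise hF] at h1
    simp at h1
  have hne : (Finset.univ.filter fun x ↦ F x = y).Nonempty := by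
    rw [← Finset.card_pos]
    exact Nat.pos_of_mul_pos_left (Fintype.card_pos.trans_le hy)
  obtain ⟨x₀, hx₀⟩ := hne
  refine ⟨(Finset.univ.filter fun x ↦ F x = y).image fun x ↦ x - x₀, ?_, ?_⟩
  · rwa [Finset.card_image_of_injective _ (sub_left_injective (b := x₀)), ← hP]
  · intro z hz ψ hψ
    obtain ⟨x, hx, rfl⟩ := Finset.mem_image.1 hz
    have hxy : F x = F x₀ := by
      rw [(Finset.mem_filter.1 hx).2, (Finset.mem_filter.1 hx₀).2]
    have hxy' := congrFun hxy ⟨ψ, hψ⟩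
    simp only [F, Prod.mk.injEq] at hxy'
    have hcell : ∀ a b : ℝ, ⌊n * a⌋ = ⌊n * b⌋ → |a - b| ≤ 1 / n := by
      intro a b hab
      have := Int.abs_sub_lt_one_of_floor_eq_floor hab
      rw [← mul_sub, abs_mul, abs_of_pos hn'] at this
      rw [le_div_iff₀ hn']
      linarith
    have hnorm : ‖ψ x - ψ x₀‖ ≤ 2 / n := by
      refine (Complex.norm_le_abs_re_add_abs_im _).trans ?_
      rw [Complex.sub_re, Complex.sub_im]
      calc _ ≤ 1 / (n : ℝ) + 1 / n := add_le_add (hcell _ _ hxy'.1) (hcell _ _ hxy'.2)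
        _ = _ := by ring
    have h0 : ‖ψ x₀‖ = 1 := AddChar.norm_apply ψ x₀
    have h0' : ψ x₀ ≠ 0 := norm_pos_iff.1 (by rw [h0]; exact one_pos)
    have : ψ (x - x₀) - 1 = (ψ x - ψ x₀) / ψ x₀ := by
      rw [AddChar.map_sub_eq_div]
      field_simp
    rw [this, norm_div, h0, div_one]
    exact hnorm

end Spectrum

section Fourier

variable {G : Type*} [AddCommGroup G] [Fintype G]

lemma sum_norm_sum_sq (Z : Finset G) :
    ∑ ψ : AddChar G ℂ, ‖∑ z ∈ Z, ψ z‖ ^ 2 = Fintype.card G * Z.card := by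
  classical
  have h : (∑ ψ : AddChar G ℂ, (‖∑ z ∈ Z, ψ z‖ : ℂ) ^ 2) = Fintype.card G * Z.card := by
    calc _ = ∑ ψ : AddChar G ℂ, ∑ z ∈ Z, ∑ w ∈ Z, ψ (z - w) := by
          refine Finset.sum_congr rfl fun ψ _ ↦ ?_
          rw [← Complex.mul_conj', map_sum, Finset.sum_mul_sum]
          refine Finset.sum_congr rfl fun z _ ↦ Finset.sum_congr rfl fun w _ ↦ ?_
          rw [sub_eq_add_neg, AddChar.map_add_eq_mul, AddChar.map_neg_eq_conj]
      _ = ∑ z ∈ Z, ∑ w ∈ Z, ∑ ψ : AddChar G ℂ, ψ (z - w) := by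
          rw [Finset.sum_comm]
          exact Finset.sum_congr rfl fun z _ ↦ Finset.sum_comm
      _ = ∑ z ∈ Z, (Fintype.card G : ℂ) := by
          refine Finset.sum_congr rfl fun z hz ↦ ?_
          simp [AddChar.sum_apply_eq_ite, sub_eq_zero, hz]
      _ = _ := by simp [mul_comm]
  exact_mod_cast h

lemma sum_norm_mul_norm_le (E Z : Finset G) :
    ∑ ψ : AddChar G ℂ, ‖∑ z ∈ Z, ψ z‖ * ‖∑ e ∈ E, ψ e‖ ≤ (Fintype.card G : ℝ) ^ 2 := by
  have hE : (E.card : ℝ) ≤ Fintype.card G := by exact_mod_cast Finset.card_le_univ E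
  have hZ : (Z.card : ℝ) ≤ Fintype.card G := by exact_mod_cast Finset.card_le_univ Z
  calc _ ≤ ∑ ψ : AddChar G ℂ, (‖∑ z ∈ Z, ψ z‖ ^ 2 + ‖∑ e ∈ E, ψ e‖ ^ 2) / 2 :=
        Finset.sum_le_sum fun ψ _ ↦ by
          nlinarith [sq_nonneg (‖∑ z ∈ Z, ψ z‖ - ‖∑ e ∈ E, ψ e‖)]
    _ = ((Fintype.card G : ℝ) * Z.card + Fintype.card G * E.card) / 2 := by
        rw [← Finset.sum_div, Finset.sum_add_distrib, sum_norm_sum_sq, sum_norm_sum_sq]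
    _ ≤ _ := by nlinarith [Nat.cast_nonneg (α := ℝ) (Fintype.card G)]

/-- Number of representations `y = z - e - (t₁ + ⋯ + tₖ)`. -/
def repCount [DecidableEq G] (E Z T : Finset G) (k : ℕ) (y : G) : ℕ :=
  ((E ×ˢ Z ×ˢ Fintype.piFinset fun _ : Fin k ↦ T).filter
    fun p ↦ p.2.1 - p.1 - ∑ i, p.2.2 i - y = 0).card

lemma card_mul_repCount [DecidableEq G] (E Z T : Finset G) (k : ℕ) (y : G) :
    (Fintype.card G * repCount E Z T k y : ℂ) = ∑ ψ : AddChar G ℂ,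
      (∑ z ∈ Z, ψ z) * (∑ e ∈ E, ψ (-e)) * (∑ t ∈ T, ψ (-t)) ^ k * ψ (-y) := by
  set P := E ×ˢ Z ×ˢ Fintype.piFinset fun _ : Fin k ↦ T
  calc (Fintype.card G * repCount E Z T k y : ℂ)
      = ∑ p ∈ P, ∑ ψ : AddChar G ℂ, ψ (p.2.1 - p.1 - ∑ i, p.2.2 i - y) := by
        simp only [AddChar.sum_apply_eq_ite, repCount, ← Finset.sum_filter, P]
        simp [mul_comm]
    _ = ∑ ψ : AddChar G ℂ, ∑ p ∈ P, ψ (p.2.1 - p.1 - ∑ i, p.2.2 i - y) := Finset.sum_comm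
    _ = _ := by
        refine Finset.sum_congr rfl fun ψ _ ↦ ?_
        have hpow : (∑ t ∈ T, ψ (-t)) ^ k =
            ∑ t ∈ Fintype.piFinset fun _ : Fin k ↦ T, ∏ i, ψ (-t i) := by
          have := Finset.prod_univ_sum (fun _ : Fin k ↦ T) fun _ t ↦ ψ (-t)
          simpa using this
        have hsum : ∀ t : Fin k → G, ψ (-∑ i, t i) = ∏ i, ψ (-t i) := by
          intro t
          rw [← Finset.sum_neg_distrib]
          exact map_sum ψ.toAddMonoidHom (fun i ↦ -t i) Finset.univ
        rw [hpow, Finset.sum_product]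
        simp_rw [Finset.sum_product]
        rw [mul_comm (∑ z ∈ Z, ψ z), Finset.sum_mul_sum, Finset.sum_mul, Finset.sum_mul]
        refine Finset.sum_congr rfl fun e _ ↦ ?_
        rw [Finset.sum_mul, Finset.sum_mul]
        refine Finset.sum_congr rfl fun z _ ↦ ?_
        rw [Finset.mul_sum, Finset.sum_mul]
        refine Finset.sum_congr rfl fun t _ ↦ ?_
        rw [← hsum, sub_eq_add_neg, sub_eq_add_neg, sub_eq_add_neg, AddChar.map_add_eq_mul,
          AddChar.map_add_eq_mul, AddChar.map_add_eq_mul]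
        ring

lemma norm_sum_neg (T : Finset G) (ψ : AddChar G ℂ) : ‖∑ t ∈ T, ψ (-t)‖ = ‖∑ t ∈ T, ψ t‖ := by
  simp_rw [AddChar.map_neg_eq_conj]
  rw [← map_sum, RCLike.norm_conj]

/-- If `y` nearly annihilates the large spectrum of `T`, then `y` is a difference of elements of
`Z` and `E`, up to a `k`-fold sum of elements of `T`. -/
lemma exists_eq_sub_sub_sum [DecidableEq G] (E Z T : Finset G) (k : ℕ) (hT : T.Nonempty)
    (hZ : ∀ e ∈ E, ∀ t : Fin k → G, (∀ i, t i ∈ T) → e + ∑ i, t i ∈ Z) (ρ : ℝ) (hρ : 0 ≤ ρ)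
    (hsmall : (ρ + 2 * (1 / 2) ^ k) * Fintype.card G < E.card) (y : G)
    (hy : ∀ ψ ∈ largeSpectrum T, ‖ψ y - 1‖ ≤ ρ) :
    ∃ e ∈ E, ∃ z ∈ Z, ∃ t : Fin k → G, (∀ i, t i ∈ T) ∧ y = z - e - ∑ i, t i := by
  by_contra! hcon
  have hT' : (0 : ℝ) < T.card := by exact_mod_cast hT.card_pos
  have hG : (0 : ℝ) < Fintype.card G := by exact_mod_cast Fintype.card_pos
  have hzero : repCount E Z T k y = 0 := by
    rw [repCount, Finset.card_eq_zero, Finset.filter_eq_empty_iff]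
    rintro ⟨e, z, t⟩ hp h0
    simp only [Finset.mem_product, Fintype.mem_piFinset] at hp
    exact hcon e hp.1 z hp.2.1 t hp.2.2 (sub_eq_zero.1 h0).symm
  have hlower : E.card * T.card ^ k ≤ repCount E Z T k 0 := by
    have : (E ×ˢ Fintype.piFinset fun _ : Fin k ↦ T).card = E.card * T.card ^ k := by simp
    rw [← this]
    refine Finset.card_le_card_of_injOn (fun p ↦ (p.1, p.1 + ∑ i, p.2 i, p.2)) ?_ ?_
    · rintro ⟨e, t⟩ hp
      simp only [Finset.coe_product, Set.mem_prod, Finset.mem_coe, Fintype.mem_piFinset] at hp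
      simp only [Finset.coe_filter, Finset.mem_product, Fintype.mem_piFinset, Set.mem_ofPred_eq]
      exact ⟨⟨hp.1, hZ e hp.1 t hp.2, hp.2⟩, by abel⟩
    · rintro ⟨e, t⟩ _ ⟨e', t'⟩ _ h
      simp only [Prod.mk.injEq] at h
      rw [h.1, h.2.2]
  have hnorm : ∀ ψ : AddChar G ℂ, ‖∑ t ∈ T, ψ t‖ ^ k * ‖1 - ψ (-y)‖ ≤
      (T.card : ℝ) ^ k * (ρ + 2 * (1 / 2) ^ k) := by
    intro ψ
    have hyy : ‖1 - ψ (-y)‖ = ‖ψ y - 1‖ := by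
      rw [norm_sub_rev, AddChar.map_neg_eq_inv, norm_inv_sub_one (AddChar.norm_apply ψ y)]
    rw [hyy]
    by_cases hψ : ψ ∈ largeSpectrum T
    · have h1 : ‖∑ t ∈ T, ψ t‖ ≤ T.card := by
        refine (norm_sum_le _ _).trans ?_
        simp [AddChar.norm_apply]
      have h2 := hy ψ hψ
      have h3 : (0 : ℝ) ≤ 2 * (1 / 2) ^ k := by positivity
      gcongr
      linarith
    · have h1 : ‖∑ t ∈ T, ψ t‖ ≤ T.card * (1 / 2) := by
        simp only [largeSpectrum, Finset.mem_filter, Finset.mem_univ, true_and, not_le] at hψ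
        linarith
      have h2 : ‖ψ y - 1‖ ≤ 2 := by
        refine (norm_sub_le _ _).trans ?_
        rw [AddChar.norm_apply, norm_one]
        norm_num
      calc _ ≤ (T.card * (1 / 2 : ℝ)) ^ k * 2 := by gcongr
        _ = (T.card : ℝ) ^ k * (0 + 2 * (1 / 2) ^ k) := by rw [mul_pow]; ring
        _ ≤ _ := by gcongr
  have hdiff : (Fintype.card G * repCount E Z T k 0 : ℂ) = ∑ ψ : AddChar G ℂ,
      (∑ z ∈ Z, ψ z) * (∑ e ∈ E, ψ (-e)) * ((∑ t ∈ T, ψ (-t)) ^ k * (1 - ψ (-y))) := by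
    have h0 := card_mul_repCount E Z T k 0
    have h1 := card_mul_repCount E Z T k y
    rw [hzero] at h1
    rw [← sub_zero (Fintype.card G * repCount E Z T k 0 : ℂ), h0]
    rw [show (0 : ℂ) = Fintype.card G * ((0 : ℕ) : ℂ) by simp, h1, ← Finset.sum_sub_distrib]
    refine Finset.sum_congr rfl fun ψ _ ↦ ?_
    rw [neg_zero, AddChar.map_zero_eq_one]
    ring
  have hupper : (Fintype.card G * repCount E Z T k 0 : ℝ) ≤
      (Fintype.card G : ℝ) ^ 2 * ((T.card : ℝ) ^ k * (ρ + 2 * (1 / 2) ^ k)) := by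
    have : (Fintype.card G * repCount E Z T k 0 : ℝ) =
        ‖(Fintype.card G * repCount E Z T k 0 : ℂ)‖ := by simp
    rw [this, hdiff]
    calc _ ≤ ∑ ψ : AddChar G ℂ, ‖∑ z ∈ Z, ψ z‖ * ‖∑ e ∈ E, ψ e‖ *
          ((T.card : ℝ) ^ k * (ρ + 2 * (1 / 2) ^ k)) := by
          refine (norm_sum_le _ _).trans (Finset.sum_le_sum fun ψ _ ↦ ?_)
          rw [norm_mul, norm_mul, norm_mul, norm_pow, norm_sum_neg, norm_sum_neg]
          exact mul_le_mul_of_nonneg_left (hnorm ψ) (by positivity)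
      _ ≤ _ := by
          rw [← Finset.sum_mul]
          gcongr
          exact sum_norm_mul_norm_le E Z
  have hlower' : (E.card : ℝ) * T.card ^ k ≤ repCount E Z T k 0 := by exact_mod_cast hlower
  have hTk : (0 : ℝ) < (T.card : ℝ) ^ k := by positivity
  have h1 : Fintype.card G * ((E.card : ℝ) * T.card ^ k) ≤
      (Fintype.card G : ℝ) ^ 2 * ((T.card : ℝ) ^ k * (ρ + 2 * (1 / 2) ^ k)) :=
    (by gcongr : _ ≤ (Fintype.card G * repCount E Z T k 0 : ℝ)).trans hupper
  have h2 : (E.card : ℝ) ≤ (ρ + 2 * (1 / 2) ^ k) * Fintype.card G := by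
    refine le_of_mul_le_mul_left ?_ (mul_pos hG hTk)
    linarith
  linarith

end Fourier

section DenseSets

open scoped _root_.Pointwise

variable {G : Type*} [AddCommGroup G] [Fintype G] [DecidableEq G]

lemma exists_small_set_of_characters (E : Finset G) (hE : E.Nonempty) (n k : ℕ) (hn : 0 < n)
    (hk : 0 < k) (ρ : ℝ) (hρ : 0 ≤ ρ)
    (hq : 8 * Real.exp (-(n / (32 * ((k + k : ℕ) : ℝ) ^ 2))) * ((k + k : ℕ) : ℝ) *
      Fintype.card G < E.card)
    (hsmall : (ρ + 2 * (1 / 2) ^ k) * Fintype.card G < E.card) :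
    ∃ Λ : Finset (AddChar G ℂ),
      (Λ.card : ℝ) ≤ 8 * Real.log (2 * (Fintype.card G / E.card : ℝ) ^ n) ∧
      ∀ y : G, ∀ r : ℝ, Λ.card * r ≤ ρ → (∀ ψ ∈ Λ, ‖ψ y - 1‖ ≤ r) →
        y ∈ E + E + E - (E + E + E) := by
  classical
  obtain ⟨T₀, hcard, hT₀⟩ := exists_sum_mem_sub E hE n hn (k + k) (by omega) hq
  have hG : (0 : ℝ) < Fintype.card G := by
    have : 0 < Fintype.card G := Fintype.card_pos_iff.2 ⟨0⟩
    exact_mod_cast this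
  have hEpos : (0 : ℝ) < E.card := by exact_mod_cast hE.card_pos
  have hT₀pos : (0 : ℝ) < T₀.card := by
    by_contra h
    have h0 : (T₀.card : ℝ) = 0 := le_antisymm (not_lt.1 h) (by positivity)
    rw [h0] at hcard
    have : (0 : ℝ) < Fintype.card G * (E.card : ℝ) ^ n := by positivity
    simp at hcard
    linarith
  have hT₀ne : T₀.Nonempty := Finset.card_pos.1 (by exact_mod_cast hT₀pos)
  set T : Finset G := T₀ - T₀ with hTdef
  have hTne : T.Nonempty := hT₀ne.sub hT₀ne
  have hTcard : (T₀.card : ℝ) ≤ T.card := by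
    exact_mod_cast Finset.card_le_card_sub_right hT₀ne
  have hneg : ∀ t ∈ T, -t ∈ T := by
    intro t ht
    obtain ⟨a, ha, b, hb, rfl⟩ := Finset.mem_sub.1 ht
    exact Finset.mem_sub.2 ⟨b, hb, a, ha, by abel⟩
  have hlog : Real.log (Fintype.card G / T.card : ℝ) ≤
      Real.log (2 * (Fintype.card G / E.card : ℝ) ^ n) := by
    apply Real.log_le_log
    · have : (0 : ℝ) < T.card := by linarith
      positivity
    · rw [div_pow, ← mul_div_assoc, div_le_div_iff₀ (by linarith) (by positivity)]
      refine hcard.trans ?_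
      have : (0 : ℝ) ≤ (Fintype.card G : ℝ) ^ n := by positivity
      nlinarith
  set d : ℕ := ⌊8 * Real.log (Fintype.card G / T.card : ℝ)⌋₊
  have hlog0 : 0 ≤ 8 * Real.log (Fintype.card G / T.card : ℝ) := by
    have : (1 : ℝ) ≤ Fintype.card G / T.card := by
      rw [one_le_div (by linarith)]
      exact_mod_cast Finset.card_le_univ T
    have := Real.log_nonneg this
    linarith
  obtain ⟨Λ, hΛ, hΛd, hspan⟩ := Finset.exists_subset_addSpan_card_le_of_forall_addDissociated
    (s := largeSpectrum T) (d := d) (fun s' hs' hdis => Nat.le_floor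
      (card_le_of_addDissociated_subset_largeSpectrum T hTne s' hs' hdis))
  refine ⟨Λ, ?_, ?_⟩
  · have : (d : ℝ) ≤ 8 * Real.log (Fintype.card G / T.card : ℝ) := Nat.floor_le hlog0
    have h2 : (Λ.card : ℝ) ≤ d := by exact_mod_cast hΛd
    linarith
  intro y r hr hy
  let Z : Finset G := Finset.univ.filter fun z => ∃ e ∈ E, ∃ t : Fin k → G,
    (∀ i, t i ∈ T) ∧ z = e + ∑ i, t i
  obtain ⟨e, he, z, hz, t, ht, rfl⟩ := exists_eq_sub_sub_sum E Z T k hTne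
    (fun e he t ht => by
      simp only [Z, Finset.mem_filter, Finset.mem_univ, true_and]
      exact ⟨e, he, t, ht, rfl⟩) ρ hρ hsmall y
    (fun ψ hψ => (norm_sub_one_le_of_mem_addSpan (hspan hψ) hy).trans hr)
  simp only [Z, Finset.mem_filter, Finset.mem_univ, true_and] at hz
  obtain ⟨e', he', t', ht', rfl⟩ := hz
  have key := hT₀ (Fin.append t' (fun i => -t i)) (by
    intro i
    refine Fin.addCases (fun i => ?_) (fun i => ?_) i
    · rw [Fin.append_left]; exact ht' i
    · rw [Fin.append_right]; exact hneg _ (ht i))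
  rw [Fin.sum_univ_add] at key
  simp only [Fin.append_left, Fin.append_right] at key
  obtain ⟨u, hu, v, hv, huv⟩ := Finset.mem_sub.1 key
  refine Finset.mem_sub.2 ⟨u + e', Finset.add_mem_add hu he', v + e,
    Finset.add_mem_add hv he, ?_⟩
  rw [Finset.sum_neg_distrib] at huv
  rw [add_sub_add_comm, huv]
  abel

lemma exists_few_characters (E : Finset G) (hE : E.Nonempty) (α : ℝ) (hα : 0 < α)
    (hα1 : α ≤ 1) (hαE : α * Fintype.card G ≤ E.card) :
    ∃ Λ : Finset (AddChar G ℂ), (Λ.card : ℝ) ≤ 100000 * Real.log (4 / α) ^ 4 ∧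
      ∀ y : G, ∀ r : ℝ, Λ.card * r ≤ α / 2 → (∀ ψ ∈ Λ, ‖ψ y - 1‖ ≤ r) →
        y ∈ E + E + E - (E + E + E) := by
  classical
  have hG : (0 : ℝ) < Fintype.card G := by
    have : 0 < Fintype.card G := Fintype.card_pos_iff.2 ⟨0⟩
    exact_mod_cast this
  have hl2 := Real.log_two_gt_d9
  obtain ⟨L, hL⟩ : ∃ L, L = Real.log (4 / α) := ⟨_, rfl⟩
  have hlog4 : Real.log 4 = 2 * Real.log 2 := by
    rw [show (4 : ℝ) = 2 ^ 2 by norm_num, Real.log_pow]; norm_num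
  have hLα : L = 2 * Real.log 2 - Real.log α := by
    rw [hL, Real.log_div (by norm_num) hα.ne', hlog4]
  have hlogα : Real.log α ≤ 0 := Real.log_nonpos hα.le hα1
  have hL2 : 2 * Real.log 2 ≤ L := by linarith
  have hL1 : 1 ≤ L := by linarith
  have hlogL : Real.log L ≤ L := (Real.log_le_sub_one_of_pos (by linarith)).trans (by linarith)
  set k : ℕ := ⌈3 * L⌉₊ with hk
  have hk3 : 3 * L ≤ k := Nat.le_ceil _
  have hk4 : (k : ℝ) ≤ 4 * L := by
    have := Nat.ceil_lt_add_one (show 0 ≤ 3 * L by linarith)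
    rw [← hk] at this
    linarith
  have hkpos : 0 < k := by
    have : (0 : ℝ) < k := by linarith
    exact_mod_cast this
  set n : ℕ := ⌈10240 * L ^ 3⌉₊ with hn
  have hL3 : 1 ≤ L ^ 3 := one_le_pow₀ hL1
  have hn1 : 10240 * L ^ 3 ≤ n := Nat.le_ceil _
  have hn2 : (n : ℝ) ≤ 10241 * L ^ 3 := by
    have := Nat.ceil_lt_add_one (show 0 ≤ 10240 * L ^ 3 by linarith)
    rw [← hn] at this
    linarith
  have hnpos : 0 < n := by
    have : (0 : ℝ) < n := by linarith
    exact_mod_cast this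
  have hhalf : (1 / 2 : ℝ) ^ k ≤ α / 8 := by
    rw [← Real.log_le_log_iff (by positivity) (by positivity), Real.log_pow,
      Real.log_div hα.ne' (by norm_num), show (8 : ℝ) = 2 ^ 3 by norm_num, Real.log_pow,
      one_div, Real.log_inv]
    push_cast
    nlinarith
  have hexp : 8 * Real.exp (-(n / (32 * ((k + k : ℕ) : ℝ) ^ 2))) * ((k + k : ℕ) : ℝ) < α := by
    have hkk : ((k + k : ℕ) : ℝ) ≤ 8 * L := by push_cast; linarith
    have hkk0 : (0 : ℝ) < ((k + k : ℕ) : ℝ) := by exact_mod_cast (by omega : 0 < k + k)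
    have h1 : 5 * L ≤ n / (32 * ((k + k : ℕ) : ℝ) ^ 2) := by
      rw [le_div_iff₀ (by positivity)]
      have : ((k + k : ℕ) : ℝ) ^ 2 ≤ (8 * L) ^ 2 := by gcongr
      nlinarith
    have h2 : Real.exp (-(n / (32 * ((k + k : ℕ) : ℝ) ^ 2))) ≤ α / (128 * L) := by
      rw [← Real.le_log_iff_exp_le (by positivity), Real.log_div hα.ne' (by positivity),
        Real.log_mul (by norm_num) (by positivity), show (128 : ℝ) = 2 ^ 7 by norm_num,
        Real.log_pow, show ((7 : ℕ) : ℝ) = 7 by norm_num]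
      linarith
    calc 8 * Real.exp (-(n / (32 * ((k + k : ℕ) : ℝ) ^ 2))) * ((k + k : ℕ) : ℝ)
        ≤ 8 * (α / (128 * L)) * (8 * L) := by gcongr
      _ = α / 2 := by field_simp; norm_num
      _ < α := by linarith
  obtain ⟨Λ, hΛ, hΛE⟩ := exists_small_set_of_characters E hE n k hnpos hkpos (α / 2)
    (by positivity) (lt_of_lt_of_le (mul_lt_mul_of_pos_right hexp hG) hαE)
    (lt_of_lt_of_le (mul_lt_mul_of_pos_right (by linarith) hG) hαE)
  have hEpos : (0 : ℝ) < E.card := by exact_mod_cast hE.card_pos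
  refine ⟨Λ, ?_, hΛE⟩
  rw [← hL]
  have h1 : Real.log (2 * (Fintype.card G / E.card : ℝ) ^ n) ≤ Real.log 2 + n * L := by
    rw [Real.log_mul (by norm_num) (by positivity), Real.log_pow]
    gcongr
    rw [hL]
    apply Real.log_le_log (by positivity)
    rw [div_le_div_iff₀ hEpos hα]
    nlinarith
  have h2 : (n : ℝ) * L ≤ 10241 * L ^ 3 * L := by gcongr
  have h3 : 1 ≤ L ^ 4 := one_le_pow₀ hL1
  nlinarith

lemma exists_many_multiples_mem (E : Finset G) (hE : E.Nonempty) (α : ℝ) (hα : 0 < α)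
    (hα1 : α ≤ 1) (hαE : α * Fintype.card G ≤ E.card) (M : ℕ) (hM : 1 ≤ M) :
    ∃ Y : Finset G,
      Real.exp (-(5000000 * Real.log (4 / α) ^ 5 * Real.log (2 * M))) * Fintype.card G ≤ Y.card ∧
      ∀ y ∈ Y, ∀ m : ℤ, |m| ≤ M → m • y ∈ E + E + E - (E + E + E) := by
  classical
  have hM' : (1 : ℝ) ≤ M := by exact_mod_cast hM
  have hl2 := Real.log_two_gt_d9
  obtain ⟨L, hL⟩ : ∃ L, L = Real.log (4 / α) := ⟨_, rfl⟩
  have hlog4 : Real.log 4 = 2 * Real.log 2 := by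
    rw [show (4 : ℝ) = 2 ^ 2 by norm_num, Real.log_pow]; norm_num
  have hLα : L = 2 * Real.log 2 - Real.log α := by
    rw [hL, Real.log_div (by norm_num) hα.ne', hlog4]
  have hlogα : Real.log α ≤ 0 := Real.log_nonpos hα.le hα1
  have hL2 : 2 * Real.log 2 ≤ L := by linarith
  have hL1 : 1 ≤ L := by linarith
  have hlogL : Real.log L ≤ L := (Real.log_le_sub_one_of_pos (by linarith)).trans (by linarith)
  obtain ⟨Λ, hΛ', hΛE⟩ := exists_few_characters E hE α hα hα1 hαE
  rw [← hL] at hΛ'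
  set D : ℝ := 100000 * L ^ 4 with hD
  have hL4 : 1 ≤ L ^ 4 := one_le_pow₀ hL1
  have hD1 : 1 ≤ D := by linarith
  set N : ℕ := ⌈4 * D * M / α⌉₊ with hN
  have hDM : 1 ≤ D * M := one_le_mul_of_one_le_of_one_le hD1 hM'
  have hDMα : 1 ≤ D * M / α := by
    rw [one_le_div hα]; linarith
  have hNle : 4 * D * M / α ≤ N := Nat.le_ceil _
  have hN4 : 4 * D * M / α = 4 * (D * M / α) := by ring
  have hNge : (N : ℝ) ≤ 5 * (D * M / α) := by
    have := Nat.ceil_lt_add_one (show 0 ≤ 4 * D * M / α by positivity)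
    rw [← hN] at this
    linarith
  have hNpos : (0 : ℝ) < N := by linarith
  obtain ⟨B, hBcard, hB⟩ := exists_bohr_set Λ N (by exact_mod_cast hNpos)
  refine ⟨B, ?_, ?_⟩
  · have hlogM : 0 ≤ Real.log M := Real.log_nonneg hM'
    have hlog2M : Real.log (2 * M) = Real.log 2 + Real.log M :=
      Real.log_mul (by norm_num) (by positivity)
    have hlogN : Real.log (2 * N + 1) ≤ 23 * L * Real.log (2 * M) := by
      have h1 : (2 * N + 1 : ℝ) ≤ 2 ^ 19 * L ^ 4 * M * (4 / α) := by
        have : (2 : ℝ) ^ 19 * L ^ 4 * M * (4 / α) = (2 ^ 21 / 100000) * (D * M / α) := by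
          rw [hD]; ring
        rw [this]
        linarith
      have h2 : Real.log (2 * N + 1) ≤ 19 * Real.log 2 + 4 * Real.log L + Real.log M + L := by
        refine (Real.log_le_log (by positivity) h1).trans_eq ?_
        rw [Real.log_mul (by positivity) (by positivity),
          Real.log_mul (by positivity) (by positivity),
          Real.log_mul (by positivity) (by positivity), Real.log_pow, Real.log_pow, ← hL]
        push_cast; ring
      rw [hlog2M]
      nlinarith
    have hexpo : ((2 * N + 1 : ℝ) ^ 2) ^ Λ.card ≤
        Real.exp (5000000 * L ^ 5 * Real.log (2 * M)) := by
      rw [← Real.log_le_iff_le_exp (by positivity), Real.log_pow, Real.log_pow]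
      have h0 : 0 ≤ Real.log (2 * N + 1) := Real.log_nonneg (by linarith)
      have h5 : 0 ≤ L ^ 5 * Real.log (2 * M) := by rw [hlog2M]; positivity
      calc (Λ.card : ℝ) * (((2 : ℕ) : ℝ) * Real.log (2 * N + 1))
          ≤ D * (2 * (23 * L * Real.log (2 * M))) := by push_cast; gcongr
        _ = 4600000 * (L ^ 5 * Real.log (2 * M)) := by rw [hD]; ring
        _ ≤ 5000000 * L ^ 5 * Real.log (2 * M) := by linarith
    have hBcard' : (Fintype.card G : ℝ) ≤ ((2 * N + 1 : ℝ) ^ 2) ^ Λ.card * B.card := by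
      exact_mod_cast hBcard
    rw [← hL, Real.exp_neg, inv_mul_le_iff₀ (Real.exp_pos _)]
    exact hBcard'.trans (by gcongr)
  · intro y hy m hm
    refine hΛE (m • y) (M * (2 / N)) ?_ fun ψ hψ => ?_
    · calc (Λ.card : ℝ) * (M * (2 / N)) ≤ D * (M * (2 / N)) := by gcongr
        _ = 2 * (D * M) / N := by ring
        _ ≤ α / 2 := by
          rw [div_le_iff₀ hNpos]
          have : α / 2 * (4 * D * M / α) ≤ α / 2 * N := by gcongr
          have h2 : α / 2 * (4 * D * M / α) = 2 * (D * M) := by field_simp; norm_num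
          linarith
    · refine (norm_zsmul_sub_one_le ψ y m).trans ?_
      have : |(m : ℝ)| ≤ M := by exact_mod_cast hm
      have := hB y hy ψ hψ
      gcongr

end DenseSets

section IntegerModel

open scoped _root_.Pointwise

lemma valMinAbs_eq_of_abs_lt {p : ℕ} [NeZero p] {r : ZMod p} {z : ℤ} (hr : r = z)
    (hz : 2 * |z| < p) : r.valMinAbs = z := by
  rw [ZMod.valMinAbs_spec]
  have := abs_lt.1 (show |z * 2| < p by rw [abs_mul, abs_two]; linarith)
  exact ⟨hr, this.1, this.2.le⟩

lemma exists_freiman_model {V : Type*} [AddCommGroup V] [DecidableEq V] {p N : ℕ} [NeZero p]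
    (f : V →+ ZMod p) (A B : Finset V) (hA : A.Nonempty) (hB : B = A + A + A - (A + A + A))
    (hf : ∀ x ∈ B + B - B, (N : ℤ) ∣ (f x).valMinAbs → x = 0) :
    ∃ E : Finset (ZMod N), A.card ≤ 36 * E.card ∧ ∀ M : ℕ, 1 ≤ M → ∀ Y : Finset (ZMod N),
      (∀ y ∈ Y, ∀ m : ℤ, |m| ≤ M → m • y ∈ E + E + E - (E + E + E)) →
      ∃ W : Finset V, W.card = Y.card ∧ ∀ v ∈ W, ∀ m : ℤ, |m| ≤ M → m • v ∈ B := by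
  classical
  have hp : 0 < p := NeZero.pos p
  have hB0 : (0 : V) ∈ B := by
    obtain ⟨a, ha⟩ := hA
    rw [hB, Finset.mem_sub]
    have := Finset.add_mem_add (Finset.add_mem_add ha ha) ha
    exact ⟨_, this, _, this, sub_self _⟩
  have hBneg : ∀ x ∈ B, -x ∈ B := by
    intro x hx
    rw [hB] at hx ⊢
    obtain ⟨a, ha, b, hb, rfl⟩ := Finset.mem_sub.1 hx
    exact Finset.mem_sub.2 ⟨b, hb, a, ha, by abel⟩
  have hBsub : ∀ x ∈ B, x ∈ B + B - B := fun x hx => Finset.mem_sub.2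
    ⟨x + 0, Finset.add_mem_add hx hB0, 0, hB0, by simp⟩
  have hzero : ∀ x ∈ B + B - B, ∀ z : ℤ, f x = z → (z : ZMod N) = 0 → 2 * |z| < p → x = 0 := by
    intro x hx z hz hz0 hlt
    apply hf x hx
    rw [valMinAbs_eq_of_abs_lt hz hlt]
    exact (ZMod.intCast_zmod_eq_zero_iff_dvd z N).1 hz0
  let u : V → ℤ := fun a => ((f a).val : ℤ)
  have hu : ∀ a, f a = (u a : ZMod p) := fun a => by simp [u]
  let g : V → ℕ := fun a => 36 * (f a).val / p
  obtain ⟨j, -, hj⟩ := Finset.exists_le_of_sum_le (s := Finset.range 36)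
    (f := fun _ => A.card) (g := fun j => 36 * (A.filter fun a => g a = j).card) (by simp)
    (by
      rw [← Finset.mul_sum, ← Finset.card_eq_sum_card_fiberwise (f := g) (t := Finset.range 36)]
      · simp
      · intro a _
        simp only [g, Finset.coe_range, Set.mem_Iio]
        rw [Nat.div_lt_iff_lt_mul hp]
        have := ZMod.val_lt (f a)
        omega)
  set A' := A.filter fun a => g a = j with hA'
  have hA'A : ∀ a ∈ A', a ∈ A := fun a ha => (Finset.mem_filter.1 ha).1
  have hdiff : ∀ a ∈ A', ∀ b ∈ A', |36 * (u a - u b)| < p := by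
    intro a ha b hb
    have h1 := (Finset.mem_filter.1 ha).2
    have h2 := (Finset.mem_filter.1 hb).2
    simp only [g] at h1 h2
    have h3 := Nat.div_add_mod (36 * (f a).val) p
    have h4 := Nat.div_add_mod (36 * (f b).val) p
    have h5 := Nat.mod_lt (36 * (f a).val) hp
    have h6 := Nat.mod_lt (36 * (f b).val) hp
    rw [h1] at h3
    rw [h2] at h4
    simp only [u]
    rw [abs_lt]
    constructor <;> omega
  have hinj : Set.InjOn (fun a => ((u a : ℤ) : ZMod N)) A' := by
    intro a ha b hb hab
    simp only at hab
    have hd := hdiff a ha b hb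
    rw [abs_mul, show |(36 : ℤ)| = 36 from rfl] at hd
    have : a - b ∈ B := by
      rw [hB]
      refine Finset.mem_sub.2 ⟨a + b + b, Finset.add_mem_add (Finset.add_mem_add (hA'A a ha)
        (hA'A b hb)) (hA'A b hb), b + b + b, Finset.add_mem_add (Finset.add_mem_add (hA'A b hb)
        (hA'A b hb)) (hA'A b hb), by abel⟩
    exact sub_eq_zero.1 (hzero _ (hBsub _ this) (u a - u b) (by rw [map_sub, hu a, hu b]; simp)
      (by push_cast; rw [hab, sub_self]) (by
        have := abs_nonneg (u a - u b)
        omega))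
  refine ⟨A'.image fun a => ((u a : ℤ) : ZMod N), by
    rw [Finset.card_image_of_injOn hinj]; exact hj, ?_⟩
  set E := A'.image fun a => ((u a : ℤ) : ZMod N) with hE
  have hlift : ∀ y ∈ E + E + E - (E + E + E), ∃ x ∈ B, ∃ z : ℤ, f x = z ∧ y = z ∧
      6 * |z| < p := by
    intro y hy
    obtain ⟨s, hs, t, ht, rfl⟩ := Finset.mem_sub.1 hy
    obtain ⟨s', hs', c₃, hc₃, rfl⟩ := Finset.mem_add.1 hs
    obtain ⟨c₁, hc₁, c₂, hc₂, rfl⟩ := Finset.mem_add.1 hs'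
    obtain ⟨t', ht', d₃, hd₃, rfl⟩ := Finset.mem_add.1 ht
    obtain ⟨d₁, hd₁, d₂, hd₂, rfl⟩ := Finset.mem_add.1 ht'
    obtain ⟨a₁, ha₁, rfl⟩ := Finset.mem_image.1 hc₁
    obtain ⟨a₂, ha₂, rfl⟩ := Finset.mem_image.1 hc₂
    obtain ⟨a₃, ha₃, rfl⟩ := Finset.mem_image.1 hc₃
    obtain ⟨b₁, hb₁, rfl⟩ := Finset.mem_image.1 hd₁
    obtain ⟨b₂, hb₂, rfl⟩ := Finset.mem_image.1 hd₂
    obtain ⟨b₃, hb₃, rfl⟩ := Finset.mem_image.1 hd₃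
    refine ⟨a₁ + a₂ + a₃ - (b₁ + b₂ + b₃), ?_, u a₁ + u a₂ + u a₃ - (u b₁ + u b₂ + u b₃),
      ?_, ?_, ?_⟩
    · rw [hB]
      exact Finset.sub_mem_sub
        (Finset.add_mem_add (Finset.add_mem_add (hA'A _ ha₁) (hA'A _ ha₂)) (hA'A _ ha₃))
        (Finset.add_mem_add (Finset.add_mem_add (hA'A _ hb₁) (hA'A _ hb₂)) (hA'A _ hb₃))
    · rw [map_sub, map_add, map_add, map_add, map_add, hu a₁, hu a₂, hu a₃, hu b₁, hu b₂, hu b₃]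
      push_cast; rfl
    · push_cast; rfl
    · have h1 := abs_lt.1 (hdiff _ ha₁ _ hb₁)
      have h2 := abs_lt.1 (hdiff _ ha₂ _ hb₂)
      have h3 := abs_lt.1 (hdiff _ ha₃ _ hb₃)
      have : |6 * (u a₁ + u a₂ + u a₃ - (u b₁ + u b₂ + u b₃))| < p := by
        rw [abs_lt]; constructor <;> linarith [h1.1, h1.2, h2.1, h2.2, h3.1, h3.2]
      rwa [abs_mul] at this
  intro M hM Y hY
  have hY1 : ∀ y ∈ Y, y ∈ E + E + E - (E + E + E) := fun y hy => by
    have := hY y hy 1 (by simpa using hM)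
    rwa [one_smul] at this
  choose! x hxB z hfx hyz hzp using hlift
  refine ⟨Y.image x, Finset.card_image_of_injOn ?_, ?_⟩
  · intro y hy y' hy' hxx
    have e1 := valMinAbs_eq_of_abs_lt (hfx y (hY1 y hy)) (by
      have := hzp y (hY1 y hy); have := abs_nonneg (z y); omega)
    have e2 := valMinAbs_eq_of_abs_lt (hfx y' (hY1 y' hy')) (by
      have := hzp y' (hY1 y' hy'); have := abs_nonneg (z y'); omega)
    rw [hyz y (hY1 y hy), hyz y' (hY1 y' hy'), ← e1, ← e2, hxx]
  · intro v hv
    obtain ⟨y, hy, rfl⟩ := Finset.mem_image.1 hv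
    have hy1 := hY1 y hy
    have key : ∀ m : ℕ, m ≤ M → m • x y = x ((m : ℤ) • y) := by
      intro m
      induction m with
      | zero =>
        intro _
        have h0 := hY y hy 0 (by simp)
        rw [zero_smul] at h0
        have := hzero _ (hBsub _ (hxB 0 h0)) (z 0) (hfx 0 h0) (hyz 0 h0).symm (by
          have := hzp 0 h0; have := abs_nonneg (z 0); omega)
        simp [this]
      | succ m ih =>
        intro hm
        have h1 := hY y hy m (by simpa using by omega)
        have h2 := hY y hy ((m + 1 : ℕ) : ℤ) (by rw [Nat.abs_cast]; exact_mod_cast hm)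
        have ih := ih (by omega)
        rw [succ_nsmul, ih]
        refine sub_eq_zero.1 (hzero _ (Finset.sub_mem_sub (Finset.add_mem_add (hxB _ h1)
          (hxB _ hy1)) (hxB _ h2))
          (z ((m : ℤ) • y) + z y - z (((m + 1 : ℕ) : ℤ) • y)) ?_ ?_ ?_)
        · rw [map_sub, map_add, hfx _ h1, hfx _ hy1, hfx _ h2]; push_cast; rfl
        · rw [Int.cast_sub, Int.cast_add, ← hyz _ h1, ← hyz _ hy1, ← hyz _ h2]
          push_cast
          rw [add_smul, one_smul, sub_self]
        · have h3 := hzp _ h1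
          have h4 := hzp _ hy1
          have h5 := hzp _ h2
          have h6 := abs_sub (z ((m : ℤ) • y) + z y) (z (((m + 1 : ℕ) : ℤ) • y))
          have h7 := abs_add_le (z ((m : ℤ) • y)) (z y)
          linarith
    have hnat : ∀ m : ℕ, m ≤ M → m • x y ∈ B := fun m hm => by
      rw [key m hm]
      exact hxB _ (hY y hy m (by simpa using hm))
    intro m hm
    obtain ⟨n, rfl | rfl⟩ := m.eq_nat_or_neg
    · rw [natCast_zsmul]
      exact hnat n (by simpa using hm)
    · rw [neg_smul, natCast_zsmul]
      exact hBneg _ (hnat n (by simpa using hm))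

lemma mul_card_filter_dvd_valMinAbs_le {p N : ℕ} [NeZero p] (hN : 0 < N) (hNp : N < p) :
    N * (Finset.univ.filter fun r : ZMod p => (N : ℤ) ∣ r.valMinAbs).card ≤ 2 * p := by
  set R := Finset.univ.filter fun r : ZMod p => (N : ℤ) ∣ r.valMinAbs
  have hle : R.card ≤ ((Finset.Ioc (-((p : ℤ) / 2) - 1) ((p : ℤ) / 2)).filter
      fun x => (N : ℤ) ∣ x).card := by
    refine Finset.card_le_card_of_injOn ZMod.valMinAbs ?_ (ZMod.injective_valMinAbs.injOn)
    intro r hr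
    have h1 := (Finset.mem_filter.1 hr).2
    have h2 := ZMod.valMinAbs_mem_Ioc r
    have h3 := h2.1
    have h4 := h2.2
    simp only [Finset.coe_filter, Finset.mem_Ioc, Set.mem_ofPred_eq]
    refine ⟨⟨?_, ?_⟩, h1⟩ <;> omega
  have hcard := Int.Ioc_filter_dvd_card (-((p : ℤ) / 2) - 1) ((p : ℤ) / 2) (r := (N : ℤ))
    (by exact_mod_cast hN)
  have hN0 : (0 : ℚ) < N := by exact_mod_cast hN
  have hNp' : (N : ℚ) + 1 ≤ p := by exact_mod_cast hNp
  have hhalf : (((p : ℤ) / 2 : ℤ) : ℚ) * 2 ≤ p := by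
    have : ((p : ℤ) / 2) * 2 ≤ p := by omega
    exact_mod_cast this
  have hfl : ((⌊(((p : ℤ) / 2 : ℤ) : ℚ) / ((N : ℤ) : ℚ)⌋ -
      ⌊((-((p : ℤ) / 2) - 1 : ℤ) : ℚ) / ((N : ℤ) : ℚ)⌋ : ℤ) : ℚ) * N ≤ 2 * p := by
    have h1 := Int.floor_le ((((p : ℤ) / 2 : ℤ) : ℚ) / ((N : ℤ) : ℚ))
    have h2 := (Int.sub_one_lt_floor (((-((p : ℤ) / 2) - 1 : ℤ) : ℚ) / ((N : ℤ) : ℚ))).le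
    rw [Int.cast_natCast] at h1 h2 ⊢
    rw [le_div_iff₀ hN0] at h1
    rw [sub_le_iff_le_add, div_le_iff₀ hN0] at h2
    push_cast at h1 h2 hhalf ⊢
    nlinarith
  have hfl' : (⌊(((p : ℤ) / 2 : ℤ) : ℚ) / ((N : ℤ) : ℚ)⌋ -
      ⌊((-((p : ℤ) / 2) - 1 : ℤ) : ℚ) / ((N : ℤ) : ℚ)⌋) * N ≤ 2 * p := by
    exact_mod_cast hfl
  have hmax : (R.card : ℤ) ≤ max (⌊(((p : ℤ) / 2 : ℤ) : ℚ) / ((N : ℤ) : ℚ)⌋ -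
      ⌊((-((p : ℤ) / 2) - 1 : ℤ) : ℚ) / ((N : ℤ) : ℚ)⌋) 0 := by
    rw [← hcard]
    exact_mod_cast hle
  have : (N : ℤ) * R.card ≤ 2 * p := by
    rcases le_max_iff.1 hmax with h | h
    · nlinarith
    · have : (N : ℤ) * R.card ≤ N * 0 := by gcongr
      omega
  exact_mod_cast this

lemma card_mul_card_filter_hom_mem {V : Type*} [AddCommGroup V] [Fintype V] {p : ℕ} [NeZero p]
    (φ : V →+ ZMod p) (hφ : Function.Surjective φ) (R : Finset (ZMod p)) :
    p * (Finset.univ.filter fun v => φ v ∈ R).card = R.card * Fintype.card V := by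
  classical
  have hfib : ∀ r : ZMod p, (Finset.univ.filter fun v => φ v = r).card =
      (Finset.univ.filter fun v => φ v = 0).card := fun r =>
    AddMonoidHom.card_fiber_eq_of_mem_range φ (hφ r) (hφ 0)
  have h1 : (Finset.univ.filter fun v => φ v ∈ R).card =
      R.card * (Finset.univ.filter fun v => φ v = 0).card := by
    rw [Finset.card_eq_sum_card_fiberwise (f := φ) (t := R) (fun v hv => by simpa using hv)]
    rw [← smul_eq_mul, ← Finset.sum_const]
    refine Finset.sum_congr rfl fun r hr => ?_
    rw [← hfib r, Finset.filter_filter]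
    congr 1
    ext v
    simp only [Finset.mem_filter, Finset.mem_univ, true_and]
    exact ⟨fun h => h.2, fun h => ⟨h ▸ hr, h⟩⟩
  have h2 : Fintype.card V = p * (Finset.univ.filter fun v => φ v = 0).card := by
    rw [← Finset.card_univ, Finset.card_eq_sum_card_fiberwise (f := φ) (t := Finset.univ)
      (fun v _ => by simp), Finset.sum_congr rfl fun r _ => hfib r]
    simp [ZMod.card]
  rw [h1, h2]
  ring

lemma exists_hom_not_dvd_valMinAbs {d : ℕ} (X : Finset (Fin d → ℤ)) (N : ℕ)
    (hN : 2 * X.card < N) :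
    ∃ p : ℕ, p.Prime ∧ ∃ f : (Fin d → ℤ) →+ ZMod p,
      ∀ x ∈ X, (N : ℤ) ∣ (f x).valMinAbs → x = 0 := by
  classical
  obtain ⟨p, hple, hp⟩ := Nat.exists_infinite_primes (N + 1 + ∑ x ∈ X, ∑ i, (x i).natAbs)
  have := Fact.mk hp
  refine ⟨p, hp, ?_⟩
  let f : (Fin d → ZMod p) → (Fin d → ℤ) →+ ZMod p := fun c =>
    { toFun := fun x => ∑ i, c i * (x i : ZMod p)
      map_zero' := by simp
      map_add' := fun x y => by simp [mul_add, Finset.sum_add_distrib] }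
  let φ : (Fin d → ℤ) → (Fin d → ZMod p) →+ ZMod p := fun x =>
    { toFun := fun c => ∑ i, c i * (x i : ZMod p)
      map_zero' := by simp
      map_add' := fun c e => by simp [add_mul, Finset.sum_add_distrib] }
  set R := Finset.univ.filter fun r : ZMod p => (N : ℤ) ∣ r.valMinAbs with hR
  have hsurj : ∀ x ∈ X, x ≠ 0 → Function.Surjective (φ x) := by
    intro x hx hx0 r
    obtain ⟨i, hi⟩ := Function.ne_iff.1 hx0
    have hxi : (x i : ZMod p) ≠ 0 := by
      rw [Ne, ZMod.intCast_zmod_eq_zero_iff_dvd]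
      intro hdvd
      have h1 := Nat.le_of_dvd (Int.natAbs_pos.2 hi) (Int.natAbs_dvd_natAbs.2 hdvd)
      have h2 : (x i).natAbs ≤ ∑ j, (x j).natAbs :=
        Finset.single_le_sum (f := fun j => (x j).natAbs) (fun _ _ => Nat.zero_le _)
          (Finset.mem_univ i)
      have h3 : ∑ j, (x j).natAbs ≤ ∑ x ∈ X, ∑ j, (x j).natAbs :=
        Finset.single_le_sum (f := fun x : Fin d → ℤ => ∑ j, (x j).natAbs)
          (fun _ _ => Nat.zero_le _) hx
      simp only [Int.natAbs_natCast] at h1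
      omega
    refine ⟨Pi.single i (r * (x i : ZMod p)⁻¹), ?_⟩
    change ∑ j, (Pi.single i (r * (x i : ZMod p)⁻¹) : Fin d → ZMod p) j * (x j : ZMod p) = r
    rw [Finset.sum_eq_single i (fun j _ hj => by simp [hj]) (by simp)]
    simp [hxi]
  let bad : (Fin d → ℤ) → Finset (Fin d → ZMod p) := fun x =>
    Finset.univ.filter fun c => φ x c ∈ R
  have hbad : ∀ x ∈ X, x ≠ 0 → N * (bad x).card ≤ 2 * Fintype.card (Fin d → ZMod p) := by
    intro x hx hx0
    have h1 := card_mul_card_filter_hom_mem (φ x) (hsurj x hx hx0) R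
    have h2 := mul_card_filter_dvd_valMinAbs_le (p := p) (N := N) (by omega) (by omega)
    refine Nat.le_of_mul_le_mul_left ?_ hp.pos
    calc p * (N * (bad x).card) = N * (p * (bad x).card) := by ring
      _ = N * R.card * Fintype.card (Fin d → ZMod p) := by rw [h1]; ring
      _ ≤ 2 * p * Fintype.card (Fin d → ZMod p) := by gcongr
      _ = p * (2 * Fintype.card (Fin d → ZMod p)) := by ring
  have hF : 0 < Fintype.card (Fin d → ZMod p) := Fintype.card_pos
  have hlt : ((X.filter fun x => x ≠ 0).biUnion bad).card < Fintype.card (Fin d → ZMod p) := by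
    refine Nat.lt_of_mul_lt_mul_left (a := N) ?_
    calc N * ((X.filter fun x => x ≠ 0).biUnion bad).card
        ≤ N * ∑ x ∈ X.filter fun x => x ≠ 0, (bad x).card := by
          gcongr; exact Finset.card_biUnion_le
      _ ≤ ∑ x ∈ X.filter fun x => x ≠ 0, 2 * Fintype.card (Fin d → ZMod p) := by
          rw [Finset.mul_sum]
          exact Finset.sum_le_sum fun x hx =>
            hbad x (Finset.mem_filter.1 hx).1 (Finset.mem_filter.1 hx).2
      _ ≤ X.card * (2 * Fintype.card (Fin d → ZMod p)) := by
          rw [Finset.sum_const, smul_eq_mul]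
          gcongr
          exact Finset.filter_subset _ _
      _ = 2 * X.card * Fintype.card (Fin d → ZMod p) := by ring
      _ < N * Fintype.card (Fin d → ZMod p) := by gcongr
  obtain ⟨c, hc⟩ : ∃ c, c ∉ (X.filter fun x => x ≠ 0).biUnion bad := by
    by_contra! h
    rw [Finset.eq_univ_iff_forall.2 h, Finset.card_univ] at hlt
    exact lt_irrefl _ hlt
  refine ⟨f c, fun x hx hdvd => ?_⟩
  by_contra hx0
  apply hc
  refine Finset.mem_biUnion.2 ⟨x, Finset.mem_filter.2 ⟨hx, hx0⟩, ?_⟩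
  simp only [bad, hR, Finset.mem_filter, Finset.mem_univ, true_and]
  exact hdvd

end IntegerModel

section IntegerLattice

open scoped _root_.Pointwise

lemma exists_many_multiples_mem_of_small_sumset {d : ℕ} (A B : Finset (Fin d → ℤ))
    (hA : A.Nonempty) (hB : B = A + A + A - (A + A + A)) (κ : ℝ) (hκ1 : 1 ≤ κ)
    (hκ : ((B + B - B).card : ℝ) ≤ κ * A.card) (M : ℕ) (hM : 1 ≤ M) :
    ∃ W : Finset (Fin d → ℤ),
      Real.exp (-(5000000 * Real.log (432 * κ) ^ 5 * Real.log (2 * M))) * A.card ≤ W.card ∧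
      ∀ v ∈ W, ∀ m : ℤ, |m| ≤ M → m • v ∈ B := by
  classical
  set X := B + B - B with hX
  have hBne : B.Nonempty := by
    rw [hB]; exact ((hA.add hA).add hA).sub ((hA.add hA).add hA)
  have hAX : A.card ≤ X.card :=
    calc A.card ≤ (A + A).card := Finset.card_le_card_add_right hA
      _ ≤ (A + A + A).card := Finset.card_le_card_add_right hA
      _ ≤ B.card := by rw [hB]; exact Finset.card_le_card_sub_right ((hA.add hA).add hA)
      _ ≤ (B + B).card := Finset.card_le_card_add_right hBne
      _ ≤ X.card := Finset.card_le_card_sub_right hBne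
  have hApos : 0 < A.card := hA.card_pos
  set N := 2 * X.card + 1 with hN
  obtain ⟨p, hp, f, hf⟩ := exists_hom_not_dvd_valMinAbs X N (by omega)
  have : NeZero p := ⟨hp.ne_zero⟩
  obtain ⟨E, hAE, hE⟩ := exists_freiman_model f A B hA hB hf
  have hEne : E.Nonempty := by
    rw [← Finset.card_pos]; omega
  have hAE' : (A.card : ℝ) ≤ 36 * E.card := by exact_mod_cast hAE
  have hN3 : (N : ℝ) ≤ 3 * X.card := by
    have : N ≤ 3 * X.card := by omega
    exact_mod_cast this
  have hNA : (A.card : ℝ) ≤ N := by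
    have : A.card ≤ N := by omega
    exact_mod_cast this
  have hEN : 1 / (108 * κ) * Fintype.card (ZMod N) ≤ E.card := by
    rw [ZMod.card, one_div, inv_mul_le_iff₀ (by positivity)]
    nlinarith
  obtain ⟨Y, hYcard, hY⟩ := exists_many_multiples_mem E hEne (1 / (108 * κ)) (by positivity)
    (by rw [div_le_one (by positivity)]; linarith) hEN M hM
  obtain ⟨W, hW, hWB⟩ := hE M hM Y hY
  refine ⟨W, ?_, hWB⟩
  rw [hW]
  refine le_trans ?_ hYcard
  rw [ZMod.card, show (4 : ℝ) / (1 / (108 * κ)) = 432 * κ by field_simp; norm_num]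
  gcongr

end IntegerLattice

section Sumsets

variable {V : Type*} [AddCommGroup V]

lemma nfoldSum_one (s : Set V) : nfoldSum 1 s = s := by
  change s + {0} = s
  rw [Set.add_singleton]
  simp

lemma nfoldSum_add (j k : ℕ) (s : Set V) :
    nfoldSum (j + k) s = nfoldSum j s + nfoldSum k s := by
  induction j with
  | zero =>
    rw [Nat.zero_add]
    change nfoldSum k s = {0} + nfoldSum k s
    rw [Set.singleton_add]
    simp
  | succ j ih =>
    rw [Nat.succ_add]
    change s + nfoldSum (j + k) s = s + nfoldSum j s + nfoldSum k s
    rw [ih, add_assoc]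

lemma neg_mem_nfoldSum {s : Set V} (hs : s = -s) (k : ℕ) {x : V} (hx : x ∈ nfoldSum k s) :
    -x ∈ nfoldSum k s := by
  induction k generalizing x with
  | zero =>
    have : x = 0 := hx
    rw [this, neg_zero]
    rfl
  | succ k ih =>
    obtain ⟨a, ha, b, hb, rfl⟩ := hx
    refine ⟨-a, ?_, -b, ih hb, by simp only; abel⟩
    rw [hs] at ha
    exact ha

lemma zero_mem_nfoldSum {s : Set V} (hs : (0 : V) ∈ s) (k : ℕ) : (0 : V) ∈ nfoldSum k s := by
  induction k with
  | zero => rfl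
  | succ k ih => exact ⟨0, hs, 0, ih, add_zero 0⟩

lemma IsApproxGroup.exists_nfoldSum_subset {K : ℝ} {H : Set V} (hK : 0 ≤ K)
    (hH : IsApproxGroup K H) (n : ℕ) :
    ∃ T : Finset V, (T.card : ℝ) ≤ K ^ n ∧ nfoldSum (n + 1) H ⊆ (T : Set V) + H := by
  classical
  obtain ⟨-, -, T₁, hT₁, hsub⟩ := hH
  induction n with
  | zero =>
    refine ⟨{0}, by simp, ?_⟩
    rw [Nat.zero_add, nfoldSum_one]
    intro x hx
    exact ⟨0, by simp, x, hx, zero_add x⟩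
  | succ n ih =>
    obtain ⟨T, hT, hTsub⟩ := ih
    refine ⟨Finset.image₂ (· + ·) T T₁, ?_, ?_⟩
    · calc ((Finset.image₂ (· + ·) T T₁).card : ℝ) ≤ T.card * T₁.card := by
            exact_mod_cast Finset.card_image₂_le _ _ _
        _ ≤ K ^ n * K := by gcongr
        _ = K ^ (n + 1) := (pow_succ K n).symm
    · rintro x ⟨a, ha, b, hb, rfl⟩
      obtain ⟨t, ht, c, hc, rfl⟩ := hTsub hb
      obtain ⟨u, hu, e, he, hue⟩ := hsub (Set.add_mem_add ha hc)
      refine ⟨t + u, Finset.mem_coe.2 (Finset.mem_image₂_of_mem ht hu), e, he, ?_⟩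
      simp only at hue ⊢
      rw [add_assoc, hue]
      abel

end Sumsets

section Discretization

variable {d : ℕ}

/-- The point `δ n` of the lattice `δ ℤᵈ`. -/
def latticePoint (δ : ℝ) : (Fin d → ℤ) →+ (Fin d → ℝ) where
  toFun n i := δ * n i
  map_zero' := by ext; simp
  map_add' m n := by ext; simp [mul_add]

lemma pairwise_disjoint_ball_latticePoint {δ r : ℝ} (hδ : 0 < δ) (hr : 2 * r ≤ δ)
    {m n : Fin d → ℤ} (hmn : m ≠ n) :
    Disjoint (Metric.ball (latticePoint δ m) r) (Metric.ball (latticePoint δ n) r) := by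
  apply Metric.ball_disjoint_ball
  obtain ⟨i, hi⟩ := Function.ne_iff.1 hmn
  refine le_trans ?_ (dist_le_pi_dist _ _ i)
  have h1 : (1 : ℝ) ≤ |(m i : ℝ) - n i| := by
    have : 1 ≤ |m i - n i| := Int.one_le_abs (sub_ne_zero.2 hi)
    exact_mod_cast this
  change r + r ≤ |δ * m i - δ * n i|
  rw [← mul_sub, abs_mul, abs_of_pos hδ]
  nlinarith

lemma card_mul_le_volume {δ r : ℝ} (hδ : 0 < δ) (hr0 : 0 < r) (hr : 2 * r ≤ δ)
    (X : Finset (Fin d → ℤ)) (U : Set (Fin d → ℝ))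
    (hU : ∀ n ∈ X, Metric.ball (latticePoint δ n) r ⊆ U) :
    ENNReal.ofReal (X.card * (2 * r) ^ d) ≤ volume U := by
  calc ENNReal.ofReal (X.card * (2 * r) ^ d)
      = ∑ n ∈ X, volume (Metric.ball (latticePoint δ n) r) := by
        rw [Finset.sum_congr rfl fun n _ => Real.volume_pi_ball (latticePoint δ n) hr0]
        rw [Finset.sum_const, nsmul_eq_mul, ENNReal.ofReal_mul (by positivity)]
        simp
    _ = volume (⋃ n ∈ X, Metric.ball (latticePoint δ n) r) := by
        rw [measure_biUnion_finset]
        · intro m _ n _ hmn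
          exact pairwise_disjoint_ball_latticePoint hδ hr hmn
        · exact fun n _ => measurableSet_ball
    _ ≤ volume U := measure_mono (Set.iUnion₂_subset hU)

lemma ball_latticePoint_add_subset {δ : ℝ} (hδ : 0 < δ) {m n : Fin d → ℤ}
    {U U' : Set (Fin d → ℝ)} (hm : Metric.ball (latticePoint δ m) (δ / 2) ⊆ U)
    (hn : Metric.ball (latticePoint δ n) (δ / 2) ⊆ U') :
    Metric.ball (latticePoint δ (m + n)) (δ / 2) ⊆ U + U' := by
  intro x hx
  refine ⟨x - latticePoint δ n, hm ?_, latticePoint δ n,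
    hn (Metric.mem_ball_self (by positivity)), by simp⟩
  rw [Metric.mem_ball, dist_eq_norm] at hx ⊢
  rw [map_add] at hx
  rwa [sub_sub, add_comm (latticePoint δ n)]

lemma ball_latticePoint_neg_subset {δ : ℝ} {n : Fin d → ℤ} {U : Set (Fin d → ℝ)}
    (hU : ∀ x ∈ U, -x ∈ U) (hn : Metric.ball (latticePoint δ n) (δ / 2) ⊆ U) :
    Metric.ball (latticePoint δ (-n)) (δ / 2) ⊆ U := by
  intro x hx
  rw [← neg_neg x]
  refine hU _ (hn ?_)
  rw [Metric.mem_ball, dist_eq_norm] at hx ⊢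
  rw [map_neg] at hx
  rwa [show -x - latticePoint δ n = -(x - -latticePoint δ n) by abel, norm_neg]

lemma exists_lattice_approximation {H : Set (Fin d → ℝ)} (hne : H.Nonempty)
    (hb : Bornology.IsBounded H) (ho : IsOpen H) :
    ∃ δ : ℝ, 0 < δ ∧ ∃ A : Finset (Fin d → ℤ),
      (∀ n ∈ A, Metric.ball (latticePoint δ n) (δ / 2) ⊆ H) ∧
      volume H ≤ ENNReal.ofReal (2 * (A.card * δ ^ d)) := by
  classical
  have hfin : volume H ≠ ∞ := hb.measure_lt_top.ne
  have hpos : volume H ≠ 0 := (ho.measure_pos volume hne).ne'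
  obtain ⟨C, hCH, hC, hCvol⟩ := ho.exists_lt_isCompact (ENNReal.half_lt_self hpos hfin)
  obtain ⟨δ, hδ, hthick⟩ := hC.exists_thickening_subset_open ho hCH
  obtain ⟨R, hR⟩ := hb.subset_closedBall 0
  have hAfin : {n : Fin d → ℤ | Metric.ball (latticePoint δ n) (δ / 2) ⊆ H}.Finite := by
    refine (Set.finite_Icc (fun _ => -⌈R / δ⌉ : Fin d → ℤ) (fun _ => ⌈R / δ⌉)).subset ?_
    intro n hn
    have h0 := hR (hn (Metric.mem_ball_self (by positivity)))
    rw [Metric.mem_closedBall, dist_zero_right] at h0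
    have key : ∀ i, |(n i : ℝ)| ≤ ⌈R / δ⌉ := by
      intro i
      refine le_trans ?_ (Int.le_ceil _)
      rw [le_div_iff₀ hδ]
      refine le_trans ?_ ((norm_le_pi_norm _ i).trans h0)
      change _ ≤ |δ * n i|
      rw [abs_mul, abs_of_pos hδ, mul_comm]
    constructor
    · intro i
      have := (abs_le.1 (key i)).1
      exact_mod_cast this
    · intro i
      have := (abs_le.1 (key i)).2
      exact_mod_cast this
  refine ⟨δ, hδ, hAfin.toFinset, fun n hn => by simpa using hn, ?_⟩
  have hcover : C ⊆ ⋃ n ∈ hAfin.toFinset, Metric.closedBall (latticePoint δ n) (δ / 2) := by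
    intro x hx
    have hdist : dist x (latticePoint δ fun i => round (x i / δ)) ≤ δ / 2 := by
      refine (dist_pi_le_iff (by positivity)).2 fun i => ?_
      change |x i - δ * round (x i / δ)| ≤ δ / 2
      have h1 := abs_sub_round (x i / δ)
      have h2 : x i - δ * round (x i / δ) = δ * (x i / δ - round (x i / δ)) := by
        field_simp
      rw [h2, abs_mul, abs_of_pos hδ]
      nlinarith
    refine Set.mem_iUnion₂.2 ⟨fun i => round (x i / δ), ?_, hdist⟩
    simp only [Set.Finite.mem_toFinset]
    intro y hy
    refine hthick (Metric.mem_thickening_iff.2 ⟨x, hx, ?_⟩)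
    have h1 := dist_triangle_right y x (latticePoint δ fun i => round (x i / δ))
    have h2 := Metric.mem_ball.1 hy
    linarith
  have hCle : volume C ≤ ENNReal.ofReal (hAfin.toFinset.card * δ ^ d) := by
    calc volume C ≤ ∑ n ∈ hAfin.toFinset, volume (Metric.closedBall (latticePoint δ n) (δ / 2)) :=
          (measure_mono hcover).trans (measure_biUnion_finset_le _ _)
      _ = ENNReal.ofReal (hAfin.toFinset.card * δ ^ d) := by
          rw [Finset.sum_congr rfl fun n _ =>
            Real.volume_pi_closedBall (latticePoint δ n) (by positivity : 0 ≤ δ / 2)]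
          rw [Finset.sum_const, nsmul_eq_mul, ENNReal.ofReal_mul (by positivity)]
          simp [mul_div_cancel₀]
  rw [ENNReal.ofReal_mul (by norm_num), ENNReal.ofReal_ofNat, mul_comm]
  exact (ENNReal.div_le_iff (by norm_num) (by norm_num)).1 (hCvol.le.trans hCle)

lemma volume_finset_add_le (T : Finset (Fin d → ℝ)) (H : Set (Fin d → ℝ)) :
    volume ((T : Set (Fin d → ℝ)) + H) ≤ T.card * volume H := by
  have : (T : Set (Fin d → ℝ)) + H = ⋃ t ∈ T, (t +ᵥ H) := by
    ext x
    simp [Set.mem_add, Set.mem_vadd_set]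
  rw [this]
  refine (measure_biUnion_finset_le _ _).trans ?_
  simp

end Discretization

section Transfer

variable {V V' : Type*} [AddCommGroup V] [AddCommGroup V']

lemma preimage_add_eq (e : V ≃+ V') (s t : Set V') : e ⁻¹' (s + t) = e ⁻¹' s + e ⁻¹' t := by
  ext x
  constructor
  · rintro ⟨a, ha, b, hb, hab⟩
    refine ⟨e.symm a, by simpa using ha, e.symm b, by simpa using hb, ?_⟩
    simp only at hab ⊢
    rw [← map_add, hab, e.symm_apply_apply]
  · rintro ⟨a, ha, b, hb, rfl⟩
    exact ⟨e a, ha, e b, hb, (map_add e a b).symm⟩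

lemma preimage_nfoldSum (e : V ≃+ V') (k : ℕ) (s : Set V') :
    e ⁻¹' nfoldSum k s = nfoldSum k (e ⁻¹' s) := by
  induction k with
  | zero =>
    ext x
    change e x = 0 ↔ x = 0
    simp
  | succ k ih =>
    change e ⁻¹' (s + nfoldSum k s) = e ⁻¹' s + nfoldSum k (e ⁻¹' s)
    rw [preimage_add_eq, ih]

lemma IsApproxGroup.preimage {K : ℝ} {H : Set V'} (hH : IsApproxGroup K H) (e : V ≃+ V') :
    IsApproxGroup K (e ⁻¹' H) := by
  obtain ⟨h0, hneg, T, hT, hsub⟩ := hH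
  refine ⟨by simpa using h0, ?_, T.map e.symm.toEquiv.toEmbedding, by simpa using hT, ?_⟩
  · ext x
    simp only [Set.mem_neg, Set.mem_preimage, map_neg]
    rw [← Set.mem_neg, ← hneg]
  · rw [← preimage_add_eq]
    refine (Set.preimage_mono hsub).trans ?_
    rw [preimage_add_eq]
    refine Set.add_subset_add_right fun x hx => ?_
    simp only [Finset.coe_map, Set.mem_image]
    exact ⟨e x, hx, e.symm_apply_apply x⟩

end Transfer

section ApproximateGroups

open scoped _root_.Pointwise

variable {d : ℕ}

lemma IsApproxGroup.volume_nfoldSum_le {K : ℝ} (hK : 0 ≤ K) {H : Set (Fin d → ℝ)}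
    (hH : IsApproxGroup K H) (n : ℕ) :
    volume (nfoldSum (n + 1) H) ≤ ENNReal.ofReal (K ^ n) * volume H := by
  obtain ⟨T, hT, hsub⟩ := hH.exists_nfoldSum_subset hK n
  refine (measure_mono hsub).trans ((volume_finset_add_le T H).trans ?_)
  gcongr
  rw [← ENNReal.ofReal_natCast]
  exact ENNReal.ofReal_le_ofReal hT

lemma IsApproxGroup.two_pow_le {K : ℝ} (hK : 0 ≤ K) {H : Set (Fin d → ℝ)}
    (hH : IsApproxGroup K H) (hpos : volume H ≠ 0) (hfin : volume H ≠ ∞) : (2 : ℝ) ^ d ≤ K := by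
  have h1 : (2 : ℝ) • H ⊆ nfoldSum (1 + 1) H := by
    rw [nfoldSum_add, nfoldSum_one]
    rintro x ⟨a, ha, rfl⟩
    exact ⟨a, ha, a, ha, by simp [two_smul]⟩
  have h2 := (measure_mono h1).trans (hH.volume_nfoldSum_le hK 1)
  rw [Measure.addHaar_smul] at h2
  have h3 := (ENNReal.mul_le_mul_iff_left hpos hfin).1 h2
  rw [ENNReal.ofReal_le_ofReal_iff (by positivity), pow_one, abs_of_nonneg (by positivity)] at h3
  simpa using h3

lemma exists_lattice_multiples {K : ℝ} (hK : 1 ≤ K) {H : Set (Fin d → ℝ)}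
    (hb : Bornology.IsBounded H) (ho : IsOpen H) (hH : IsApproxGroup K H) (M : ℕ) (hM : 1 ≤ M) :
    ∃ δ : ℝ, 0 < δ ∧ ∃ W : Finset (Fin d → ℤ),
      ENNReal.ofReal
        (1 / 2 * Real.exp (-(5000000 * Real.log (864 * K ^ 17) ^ 5 * Real.log (2 * M)))) *
          volume H ≤ ENNReal.ofReal (W.card * δ ^ d) ∧
      ∀ v ∈ W, ∀ m : ℤ, |m| ≤ M →
        Metric.ball (latticePoint δ (m • v)) (δ / 2) ⊆ nfoldSum 6 H := by
  classical
  have hne : H.Nonempty := ⟨0, hH.1⟩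
  have hfin : volume H ≠ ∞ := hb.measure_lt_top.ne
  have hpos : volume H ≠ 0 := (ho.measure_pos volume hne).ne'
  obtain ⟨δ, hδ, A, hAball, hAvol⟩ := exists_lattice_approximation hne hb ho
  have hAne : A.Nonempty := by
    by_contra h
    rw [Finset.not_nonempty_iff_eq_empty] at h
    rw [h] at hAvol
    simp [hpos] at hAvol
  set B := A + A + A - (A + A + A) with hB
  have hA3 : ∀ n ∈ A + A + A, Metric.ball (latticePoint δ n) (δ / 2) ⊆ nfoldSum 3 H := by
    intro n hn
    obtain ⟨s, hs, c, hc, rfl⟩ := Finset.mem_add.1 hn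
    obtain ⟨a, ha, b, hb, rfl⟩ := Finset.mem_add.1 hs
    have := ball_latticePoint_add_subset hδ
      (ball_latticePoint_add_subset hδ (hAball a ha) (hAball b hb)) (hAball c hc)
    rwa [show 3 = 1 + 1 + 1 from rfl, nfoldSum_add, nfoldSum_add, nfoldSum_one]
  have hBball : ∀ n ∈ B, Metric.ball (latticePoint δ n) (δ / 2) ⊆ nfoldSum 6 H := by
    intro n hn
    obtain ⟨s, hs, t, ht, rfl⟩ := Finset.mem_sub.1 hn
    have := ball_latticePoint_add_subset hδ (hA3 s hs)
      (ball_latticePoint_neg_subset (fun x hx => neg_mem_nfoldSum hH.2.1 3 hx) (hA3 t ht))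
    rwa [← sub_eq_add_neg, ← nfoldSum_add] at this
  have hXball : ∀ n ∈ B + B - B, Metric.ball (latticePoint δ n) (δ / 2) ⊆ nfoldSum 18 H := by
    intro n hn
    obtain ⟨s, hs, c, hc, rfl⟩ := Finset.mem_sub.1 hn
    obtain ⟨a, ha, b, hb, rfl⟩ := Finset.mem_add.1 hs
    have := ball_latticePoint_add_subset hδ
      (ball_latticePoint_add_subset hδ (hBball a ha) (hBball b hb))
      (ball_latticePoint_neg_subset (fun x hx => neg_mem_nfoldSum hH.2.1 6 hx) (hBball c hc))
    rwa [← sub_eq_add_neg, ← nfoldSum_add, ← nfoldSum_add] at this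
  have hX : ((B + B - B).card : ℝ) ≤ 2 * K ^ 17 * A.card := by
    have h1 := card_mul_le_volume hδ (half_pos hδ) (by linarith) (B + B - B) _ hXball
    have h2 := h1.trans (hH.volume_nfoldSum_le (by linarith) 17)
    have h3 : ENNReal.ofReal (K ^ 17) * volume H ≤
        ENNReal.ofReal (K ^ 17 * (2 * (A.card * δ ^ d))) := by
      rw [ENNReal.ofReal_mul (by positivity)]
      gcongr
    have h4 := (ENNReal.ofReal_le_ofReal_iff (by positivity)).1 (h2.trans h3)
    rw [mul_div_cancel₀ δ (two_ne_zero)] at h4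
    have h5 : 0 < δ ^ d := by positivity
    nlinarith
  obtain ⟨W, hWcard, hW⟩ := exists_many_multiples_mem_of_small_sumset A B hAne hB (2 * K ^ 17)
    (by have : 1 ≤ K ^ 17 := one_le_pow₀ hK
        linarith) hX M hM
  refine ⟨δ, hδ, W, ?_, fun v hv m hm => hBball _ (hW v hv m hm)⟩
  rw [show 432 * (2 * K ^ 17) = 864 * K ^ 17 by ring] at hWcard
  refine (mul_le_mul_right hAvol _).trans ?_
  rw [← ENNReal.ofReal_mul (by positivity)]
  apply ENNReal.ofReal_le_ofReal
  have h5 : 0 < δ ^ d := by positivity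
  nlinarith

lemma volume_multiples_ge {K : ℝ} (hK : 1 ≤ K) {H : Set (Fin d → ℝ)}
    (hb : Bornology.IsBounded H) (ho : IsOpen H) (hH : IsApproxGroup K H) (M : ℕ) (hM : 1 ≤ M) :
    ENNReal.ofReal
        (1 / 2 * Real.exp (-(5000000 * Real.log (864 * K ^ 17) ^ 5 * Real.log (2 * M))) *
          ((M : ℝ) ^ d)⁻¹) * volume H ≤
      volume {v : Fin d → ℝ | ∀ m : ℤ, |m| ≤ M → m • v ∈ nfoldSum 8 H} := by
  obtain ⟨δ, hδ, W, hWcard, hW⟩ := exists_lattice_multiples hK hb ho hH M hM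
  have hM' : (1 : ℝ) ≤ M := by exact_mod_cast hM
  have hball : ∀ v ∈ W, Metric.ball (latticePoint δ v) (δ / (2 * M)) ⊆
      {v : Fin d → ℝ | ∀ m : ℤ, |m| ≤ M → m • v ∈ nfoldSum 8 H} := by
    intro v hv x hx m hm
    rw [nfoldSum_add 6 2]
    refine ⟨m • x, hW v hv m hm ?_, 0, zero_mem_nfoldSum hH.1 2, add_zero _⟩
    rw [Metric.mem_ball, dist_eq_norm] at hx ⊢
    rw [map_zsmul, ← smul_sub, norm_smul, Int.norm_eq_abs]
    have hm' : |(m : ℝ)| ≤ M := by exact_mod_cast hm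
    calc |(m : ℝ)| * ‖x - latticePoint δ v‖ ≤ M * ‖x - latticePoint δ v‖ := by gcongr
      _ < M * (δ / (2 * M)) := by gcongr
      _ = δ / 2 := by field_simp
  refine le_trans ?_ (card_mul_le_volume hδ (by positivity) ?_ W _ hball)
  · rw [mul_comm (1 / 2 * _), ENNReal.ofReal_mul (by positivity), mul_assoc]
    refine (mul_le_mul_right hWcard _).trans ?_
    rw [← ENNReal.ofReal_mul (by positivity)]
    apply le_of_eq
    congr 1
    rw [show 2 * (δ / (2 * M)) = δ / M by field_simp, div_pow]
    ring
  · rw [show 2 * (δ / (2 * M)) = δ / M by field_simp]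
    exact div_le_self hδ.le hM'

lemma exp_neg_le_of_two_pow_le (hd : 1 ≤ d) {K : ℝ} (hK : 1 ≤ K) (hdK : (2 : ℝ) ^ d ≤ K) (M : ℕ)
    (hM : 1 ≤ M) {A : ℝ} (hA : 10 ^ 13 ≤ A) :
    Real.exp (-A * Real.log (2 * K) ^ A * Real.log (2 * M)) ≤
      Real.exp (-(5000000 * Real.log (864 * K ^ 17) ^ 5 * Real.log (2 * M))) *
        ((M : ℝ) ^ d)⁻¹ := by
  have hM' : (1 : ℝ) ≤ M := by exact_mod_cast hM
  have hd' : (1 : ℝ) ≤ d := by exact_mod_cast hd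
  have hl2 := Real.log_two_gt_d9
  have hlogM : 0 ≤ Real.log M := Real.log_nonneg hM'
  have hlog2M : Real.log (2 * M) = Real.log 2 + Real.log M :=
    Real.log_mul (by norm_num) (by positivity)
  have hlog2K : Real.log (2 * K) = Real.log 2 + Real.log K :=
    Real.log_mul (by norm_num) (by positivity)
  have hdlog : d * Real.log 2 ≤ Real.log K := by
    rw [← Real.log_pow]
    exact Real.log_le_log (by positivity) hdK
  set ℓ := Real.log (2 * K)
  set q := Real.log (2 * M)
  have hq : 0 ≤ q := by linarith
  have hℓ : 1 ≤ ℓ := by nlinarith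
  have hℓ5 : 1 ≤ ℓ ^ 4 := one_le_pow₀ hℓ
  have hlog864 : Real.log (864 * K ^ 17) ≤ 17 * ℓ := by
    have : Real.log (864 * K ^ 17) ≤ Real.log ((2 * K) ^ 17) := by
      apply Real.log_le_log (by positivity)
      rw [mul_pow]
      gcongr
      norm_num
    rwa [Real.log_pow] at this
  have hlog0 : 0 ≤ Real.log (864 * K ^ 17) := by
    apply Real.log_nonneg
    have : 1 ≤ K ^ 17 := one_le_pow₀ hK
    linarith
  have h5 : Real.log (864 * K ^ 17) ^ 5 ≤ (17 * ℓ) ^ 5 := by gcongr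
  have hrpow : ℓ ^ 5 ≤ ℓ ^ A := by
    rw [← Real.rpow_natCast]
    apply Real.rpow_le_rpow_of_exponent_le hℓ
    push_cast
    linarith
  have hMd : d * Real.log M ≤ 2 * ℓ ^ 5 * q := by
    calc d * Real.log M ≤ (2 * ℓ) * q := by
          gcongr
          · nlinarith
          · linarith
      _ ≤ 2 * ℓ ^ 5 * q := by
          gcongr
          nlinarith
  rw [show ((M : ℝ) ^ d)⁻¹ = Real.exp (-(d * Real.log M)) by
    rw [Real.exp_neg, ← Real.log_pow, Real.exp_log (by positivity)], ← Real.exp_add]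
  apply Real.exp_le_exp.2
  have h6 : 10 ^ 13 * ℓ ^ 5 * q ≤ A * ℓ ^ A * q := by gcongr
  have h7 : 5000000 * Real.log (864 * K ^ 17) ^ 5 * q ≤ 5000000 * (17 * ℓ) ^ 5 * q := by gcongr
  have h8 : 0 ≤ ℓ ^ 5 * q := by positivity
  linarith

end ApproximateGroups

/-- **Approximate groups contain many progression generators.** There are absolute
constants `c, A > 0` such that for every `d ≥ 1`, every `K ≥ 1`, every bounded open
`K`-approximate group `H ⊆ ℝᵈ` and every natural number `M ≥ 1`, the set
`S = {v : m v ∈ 8H for all -M ≤ m ≤ M}` satisfies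
`|S| ≥ c exp(-A (log 2K)^A log 2M) |H|`. -/
theorem approx_group_contains_progressions :
    ∃ c A : ℝ, 0 < c ∧ 0 < A ∧
      ∀ (d : ℕ), 1 ≤ d → ∀ K : ℝ, 1 ≤ K →
        ∀ H : Set (EuclideanSpace ℝ (Fin d)),
          Bornology.IsBounded H → IsOpen H → IsApproxGroup K H →
          ∀ M : ℕ, 1 ≤ M →
            ENNReal.ofReal
                (c * Real.exp (-A * Real.log (2 * K) ^ A * Real.log (2 * M))) *
              volume H ≤
            volume {v : EuclideanSpace ℝ (Fin d) |
              ∀ m : ℤ, -(M : ℤ) ≤ m → m ≤ (M : ℤ) → m • v ∈ nfoldSum 8 H} := by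
  refine ⟨1 / 2, 10 ^ 13, by norm_num, by norm_num, ?_⟩
  intro d hd K hK H hb ho hH M hM
  let e : (Fin d → ℝ) ≃L[ℝ] EuclideanSpace ℝ (Fin d) := (EuclideanSpace.equiv (Fin d) ℝ).symm
  have hvol : ∀ U : Set (EuclideanSpace ℝ (Fin d)), volume (e ⁻¹' U) = volume U :=
    (EuclideanSpace.volume_preserving_symm_measurableEquiv_toLp (Fin d)).symm.measure_preimage_equiv
  have hb' : Bornology.IsBounded (e ⁻¹' H) := by
    rw [← e.image_symm_eq_preimage]
    exact e.symm.lipschitz.isBounded_image hb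
  have ho' : IsOpen (e ⁻¹' H) := ho.preimage e.continuous
  have hH' : IsApproxGroup K (e ⁻¹' H) := hH.preimage e.toLinearEquiv.toAddEquiv
  have hne : (e ⁻¹' H).Nonempty := ⟨0, hH'.1⟩
  have hdK := hH'.two_pow_le (by linarith) (ho'.measure_pos volume hne).ne' hb'.measure_lt_top.ne
  have hset : {v : Fin d → ℝ | ∀ m : ℤ, |m| ≤ M → m • v ∈ nfoldSum 8 (e ⁻¹' H)} =
      e ⁻¹' {v : EuclideanSpace ℝ (Fin d) |
        ∀ m : ℤ, -(M : ℤ) ≤ m → m ≤ (M : ℤ) → m • v ∈ nfoldSum 8 H} := by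
    ext v
    refine forall_congr' fun m => ?_
    rw [abs_le, and_imp, ← map_zsmul e m v]
    have : nfoldSum 8 (e ⁻¹' H) = e ⁻¹' nfoldSum 8 H :=
      (preimage_nfoldSum e.toLinearEquiv.toAddEquiv 8 H).symm
    rw [this]
    rfl
  rw [← hvol H, ← hvol, ← hset]
  refine le_trans ?_ (volume_multiples_ge hK hb' ho' hH' M hM)
  rw [mul_assoc (1 / 2 : ℝ)]
  gcongr
  exact exp_neg_le_of_two_pow_le hd hK hdK M hM le_rfl
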